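/- Assume d ≥ 3, Ω is irreducible, and the torsion-free group Γ divides Ω. Let F₁ and F₂ be distinct flats of Ω, let (xᵢ) be a sequence in F₁ converging to x∞ ∈ ∂F₁ and (yᵢ) a sequence in F₂ converging to y∞ ∈ ∂F₂, with xᵢ ≠ yᵢ for all i, and for each i let zᵢ, wᵢ ∈ ∂Ω be collinear with xᵢ, yᵢ, with xᵢ strictly between zᵢ and yᵢ and yᵢ strictly between xᵢ and wᵢ. Then the cross-ratios [zᵢ, xᵢ, yᵢ, wᵢ] tend to +∞ as i → ∞ (equivalently, the Hilbert distance between xᵢ and yᵢ tends to infinity). -/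

import Mathlib

open Set Filter Metric

noncomputable section

/-- `ℝ^d`. -/
abbrev Euc (d : ℕ) := EuclideanSpace ℝ (Fin d)

/-- A flat of `Ω` with prescribed vertices `v`. -/
def IsFlatWith {d : ℕ} (Ω : Set (Euc d)) (v : Fin d → Euc d) : Prop :=
  AffineIndependent ℝ v ∧
  (∀ j, v j ∈ closure Ω \ Ω) ∧
  intrinsicInterior ℝ (convexHull ℝ (Set.range v)) ⊆ Ω ∧
  convexHull ℝ (Set.range v) \ intrinsicInterior ℝ (convexHull ℝ (Set.range v)) ⊆ closure Ω \ Ω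

/-- A (codimension-one, properly embedded) flat of `Ω`. -/
def IsFlat {d : ℕ} (Ω : Set (Euc d)) (F : Set (Euc d)) : Prop :=
  ∃ v : Fin d → Euc d, IsFlatWith Ω v ∧ F = intrinsicInterior ℝ (convexHull ℝ (Set.range v))

/-- The cone over a subset of `ℝ^d`, inside `ℝ^d × ℝ ≅ ℝ^{d+1}`. -/
def coneOver {d : ℕ} (S : Set (Euc d)) : Set (Euc d × ℝ) :=
  {p | ∃ t : ℝ, 0 < t ∧ ∃ x ∈ S, p = t • (x, (1 : ℝ))}

/-- Irreducibility of a properly convex domain: its cone admits no direct-sum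
decomposition into convex cones. -/
def IsIrreducibleDomain {d : ℕ} (Ω : Set (Euc d)) : Prop :=
  ¬ ∃ (V₁ V₂ : Submodule ℝ (Euc d × ℝ)) (C₁ C₂ : Set (Euc d × ℝ)),
      V₁ ≠ ⊥ ∧ V₂ ≠ ⊥ ∧ V₁ ≠ ⊤ ∧ V₂ ≠ ⊤ ∧ IsCompl V₁ V₂ ∧
      C₁ ⊆ (V₁ : Set (Euc d × ℝ)) ∧ C₂ ⊆ (V₂ : Set (Euc d × ℝ)) ∧
      Convex ℝ C₁ ∧ Convex ℝ C₂ ∧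
      (∀ t : ℝ, 0 < t → ∀ c ∈ C₁, t • c ∈ C₁) ∧
      (∀ t : ℝ, 0 < t → ∀ c ∈ C₂, t • c ∈ C₂) ∧
      coneOver Ω = {p | ∃ c₁ ∈ C₁, ∃ c₂ ∈ C₂, p = c₁ + c₂}

/-- The homeomorphism of `Ω` induced by a linear automorphism of `ℝ^{d+1}`
preserving the cone over `Ω`. -/
def projAct {d : ℕ} (g : (Euc d × ℝ) ≃ₗ[ℝ] (Euc d × ℝ)) (x : Euc d) : Euc d :=
  ((g (x, 1)).2)⁻¹ • (g (x, 1)).1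

/-- `Γ` divides `Ω`: every element preserves the cone over `Ω`; the induced action on `Ω`
is free and properly discontinuous, and admits a compact set whose translates cover `Ω`. -/
def Divides {d : ℕ} (Ω : Set (Euc d))
    (Γ : Subgroup ((Euc d × ℝ) ≃ₗ[ℝ] (Euc d × ℝ))) : Prop :=
  (∀ γ ∈ Γ, (γ : (Euc d × ℝ) ≃ₗ[ℝ] (Euc d × ℝ)) '' coneOver Ω = coneOver Ω) ∧
  (∀ γ ∈ Γ, γ ≠ 1 → ∀ x ∈ Ω, projAct γ x ≠ x) ∧
  (∀ K : Set (Euc d), K ⊆ Ω → IsCompact K →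
    {γ : (Euc d × ℝ) ≃ₗ[ℝ] (Euc d × ℝ) | γ ∈ Γ ∧ (projAct γ '' K ∩ K).Nonempty}.Finite) ∧
  (∃ K : Set (Euc d), K ⊆ Ω ∧ IsCompact K ∧ (⋃ γ ∈ Γ, projAct γ '' K) = Ω)

/-- `Γ` is torsion-free. -/
def TorsionFreeSub {d : ℕ} (Γ : Subgroup ((Euc d × ℝ) ≃ₗ[ℝ] (Euc d × ℝ))) : Prop :=
  ∀ γ ∈ Γ, ∀ n : ℕ, n ≠ 0 → γ ^ n = 1 → γ = 1

/-- Convergence of a sequence of flats: Hausdorff convergence of their closures. -/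
def FlatsConverge {d : ℕ} (Fs : ℕ → Set (Euc d)) (F : Set (Euc d)) : Prop :=
  Tendsto (fun i => hausdorffDist (closure (Fs i)) (closure F)) atTop (nhds 0)

/-- A flat is isolated if no sequence of flats, all distinct from it, converges to it. -/
def IsIsolatedFlat {d : ℕ} (Ω F : Set (Euc d)) : Prop :=
  ¬ ∃ Fs : ℕ → Set (Euc d), (∀ i, IsFlat Ω (Fs i)) ∧ (∀ i, Fs i ≠ F) ∧ FlatsConverge Fs F

/-- The union of all flats of `Ω`. -/
def flatsUnion {d : ℕ} (Ω : Set (Euc d)) : Set (Euc d) := ⋃₀ {F | IsFlat Ω F}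

/-- A boundary flat: a flat contained in the closure of a connected component of the
complement of the union of all flats. -/
def IsBoundaryFlat {d : ℕ} (Ω F : Set (Euc d)) : Prop :=
  IsFlat Ω F ∧ ∃ x ∈ Ω \ flatsUnion Ω,
    F ⊆ closure (connectedComponentIn (Ω \ flatsUnion Ω) x)

/-- The cross-ratio of four collinear points, `a` between `z` and `b`, `b` between `a` and `w`. -/
def crossRatio {d : ℕ} (z a b w : Euc d) : ℝ :=
  (‖z - b‖ * ‖a - w‖) / (‖z - a‖ * ‖b - w‖)

/-! ### Open sharp cones -/

section Cones

variable {V : Type*} [NormedAddCommGroup V] [NormedSpace ℝ V]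

/-- A nonempty open convex cone on which the linear functional `h` dominates the norm. -/
structure IsSharpCone (C : Set V) (h : V →L[ℝ] ℝ) : Prop where
  isOpen : IsOpen C
  convex : Convex ℝ C
  smul_mem : ∀ {t : ℝ}, 0 < t → ∀ {p : V}, p ∈ C → t • p ∈ C
  nonempty : C.Nonempty
  norm_le : ∀ {p : V}, p ∈ C → ‖p‖ ≤ h p

/-- The linear automorphisms of the cone `C` move every point of `C` into the compact set `K`. -/
structure IsCocompactCone (C K : Set V) : Prop where
  subset : K ⊆ C
  isCompact : IsCompact K
  exists_map_mem : ∀ u ∈ C, ∃ g : V ≃L[ℝ] V, (∀ p, g p ∈ C ↔ p ∈ C) ∧ g u ∈ K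

/-- No nontrivial linear projection splits the cone `C`. -/
def IsIndecomposableCone (C : Set V) : Prop :=
  ∀ Q : V →L[ℝ] V, (∀ p, Q (Q p) = Q p) →
    (∀ p ∈ C, Q p ∈ closure C ∧ p - Q p ∈ closure C) →
    (∀ p, Q p = 0) ∨ ∀ p, Q p = p

namespace IsSharpCone

variable {C : Set V} {h : V →L[ℝ] ℝ}

lemma add_mem (hC : IsSharpCone C h) {p q : V} (hp : p ∈ C) (hq : q ∈ C) : p + q ∈ C := by
  have h1 := hC.convex hp hq (a := 1 / 2) (b := 1 / 2) (by norm_num) (by norm_num) (by norm_num)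
  have h2 := hC.smul_mem (t := 2) (by norm_num) h1
  simpa [smul_smul, smul_add] using h2

lemma closure_smul_mem (hC : IsSharpCone C h) {t : ℝ} (ht : 0 < t) {p : V}
    (hp : p ∈ closure C) : t • p ∈ closure C :=
  map_mem_closure (continuous_const_smul t) hp fun _ hq => hC.smul_mem ht hq

lemma zero_mem_closure (hC : IsSharpCone C h) : (0 : V) ∈ closure C := by
  obtain ⟨p, hp⟩ := hC.nonempty
  have h1 : Tendsto (fun t : ℝ => t • p) (nhdsWithin 0 (Ioi 0)) (nhds ((0 : ℝ) • p)) :=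
    ((continuous_id.smul continuous_const).tendsto (0 : ℝ)).mono_left nhdsWithin_le_nhds
  rw [zero_smul] at h1
  exact mem_closure_of_tendsto h1
    (eventually_nhdsWithin_of_forall fun t ht => hC.smul_mem ht hp)

lemma closure_smul_mem_of_nonneg (hC : IsSharpCone C h) {t : ℝ} (ht : 0 ≤ t) {p : V}
    (hp : p ∈ closure C) : t • p ∈ closure C := by
  rcases ht.eq_or_lt with rfl | ht
  · simpa using hC.zero_mem_closure
  · exact hC.closure_smul_mem ht hp

lemma closure_add_mem (hC : IsSharpCone C h) {p q : V} (hp : p ∈ closure C)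
    (hq : q ∈ closure C) : p + q ∈ closure C :=
  map_mem_closure₂ continuous_add hp hq fun _ ha _ hb => hC.add_mem ha hb

lemma interior_closure (hC : IsSharpCone C h) : interior (closure C) = C := by
  rw [hC.convex.interior_closure_eq_interior_of_nonempty_interior, hC.isOpen.interior_eq]
  rw [hC.isOpen.interior_eq]; exact hC.nonempty

lemma add_closure_mem (hC : IsSharpCone C h) {p q : V} (hp : p ∈ C)
    (hq : q ∈ closure C) : p + q ∈ C := by
  have ho : IsOpen ((fun a => a + q) '' C) := (Homeomorph.addRight q).isOpenMap _ hC.isOpen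
  have hs : (fun a => a + q) '' C ⊆ closure C := by
    rintro _ ⟨a, ha, rfl⟩
    exact hC.closure_add_mem (subset_closure ha) hq
  have := interior_maximal hs ho
  rw [hC.interior_closure] at this
  exact this ⟨p, hp, rfl⟩

lemma closure_sum_mem (hC : IsSharpCone C h) {ι : Type*} (s : Finset ι) {f : ι → V}
    (hf : ∀ i ∈ s, f i ∈ closure C) : ∑ i ∈ s, f i ∈ closure C := by
  classical
  induction s using Finset.induction_on with
  | empty => simpa using hC.zero_mem_closure
  | insert a s ha ih =>
    rw [Finset.sum_insert ha]
    exact hC.closure_add_mem (hf a (Finset.mem_insert_self a s))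
      (ih fun i hi => hf i (Finset.mem_insert_of_mem hi))

lemma norm_le_closure (hC : IsSharpCone C h) {p : V} (hp : p ∈ closure C) : ‖p‖ ≤ h p :=
  closure_minimal (s := C) (t := {p | ‖p‖ ≤ h p}) (fun _ hq => hC.norm_le hq)
    (isClosed_le continuous_norm h.continuous) hp

lemma nonneg_closure (hC : IsSharpCone C h) {p : V} (hp : p ∈ closure C) : 0 ≤ h p :=
  (norm_nonneg p).trans (hC.norm_le_closure hp)

lemma pos_of_ne_zero (hC : IsSharpCone C h) {p : V} (hp : p ∈ closure C) (h0 : p ≠ 0) :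
    0 < h p :=
  (norm_pos_iff.2 h0).trans_le (hC.norm_le_closure hp)

/-- The order interval below `q` is bounded. -/
lemma norm_le_of_sub_mem (hC : IsSharpCone C h) {p q : V} (hp : p ∈ closure C)
    (hq : q - p ∈ closure C) : ‖p‖ ≤ h q := by
  have h1 := hC.nonneg_closure hq
  rw [map_sub] at h1
  linarith [hC.norm_le_closure hp]

/-- A linear functional that is nonnegative on `C` and not identically zero is positive on `C`. -/
lemma functional_pos (hC : IsSharpCone C h) {f : V →L[ℝ] ℝ} (hf : ∀ p ∈ C, 0 ≤ f p)
    {e : V} (he : 0 < f e) {p : V} (hp : p ∈ C) : 0 < f p := by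
  have ht : Tendsto (fun t : ℝ => p - t • e) (nhdsWithin 0 (Ioi 0)) (nhds (p - (0 : ℝ) • e)) :=
    ((continuous_const.sub (continuous_id.smul continuous_const)).tendsto (0 : ℝ)).mono_left
      nhdsWithin_le_nhds
  rw [zero_smul, sub_zero] at ht
  obtain ⟨t, htC, ht0⟩ := ((ht.eventually (hC.isOpen.mem_nhds hp)).and
    self_mem_nhdsWithin).exists
  have h1 := hf _ htC
  rw [map_sub, map_smul, smul_eq_mul] at h1
  have h2 : 0 < t * f e := mul_pos ht0 he
  linarith

lemma functional_nonneg_closure {f : V →L[ℝ] ℝ} (hf : ∀ p ∈ C, 0 ≤ f p) {p : V}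
    (hp : p ∈ closure C) : 0 ≤ f p :=
  closure_minimal (s := C) (t := {p | 0 ≤ f p}) hf (isClosed_le continuous_const f.continuous) hp

lemma map_closure {g : V ≃L[ℝ] V} (hg : ∀ p, g p ∈ C ↔ p ∈ C) {p : V} (hp : p ∈ closure C) :
    g p ∈ closure C :=
  map_mem_closure g.continuous hp fun q hq => (hg q).2 hq

/-- Positive combinations of a basis consisting of vectors of `closure C` lie in `C`. -/
lemma basis_sum_mem (hC : IsSharpCone C h) [FiniteDimensional ℝ V] {κ : Type*} [Fintype κ]
    (b : Module.Basis κ ℝ V) (hb : ∀ i, b i ∈ closure C) {c : κ → ℝ} (hc : ∀ i, 0 < c i) :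
    ∑ i, c i • b i ∈ C := by
  have ho : IsOpen {p : V | ∀ i, 0 < b.repr p i} := by
    simp only [ofPred_forall]
    refine isOpen_iInter_of_finite fun i => ?_
    exact isOpen_lt continuous_const (b.coord i).continuous_of_finiteDimensional
  have hs : {p : V | ∀ i, 0 < b.repr p i} ⊆ closure C := by
    intro p hp
    rw [← b.sum_repr p]
    exact hC.closure_sum_mem _ fun i _ => hC.closure_smul_mem (hp i) (hb i)
  have := interior_maximal hs ho
  rw [hC.interior_closure] at this
  refine this fun i => ?_
  rw [b.repr_sum_self]
  exact hc i

end IsSharpCone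

/-- Bounded families in a proper space converge along ultrafilters. -/
lemma exists_tendsto_ultrafilter_of_norm_le {E : Type*} [NormedAddCommGroup E] [ProperSpace E]
    {α : Type*} (U : Ultrafilter α) (f : α → E) (R : ℝ) (hf : ∀ᶠ n in (U : Filter α), ‖f n‖ ≤ R) :
    ∃ x, Tendsto f U (nhds x) := by
  obtain ⟨x, -, hx⟩ := (isCompact_closedBall (0 : E) R).ultrafilter_le_nhds (U.map f)
    (by
      rw [le_principal_iff, Ultrafilter.mem_coe, Ultrafilter.mem_map]
      filter_upwards [hf] with n hn
      simpa using hn)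
  exact ⟨x, hx⟩

end Cones

section Rescaling

variable {V : Type*} [NormedAddCommGroup V] [NormedSpace ℝ V] {C K : Set V} {h : V →L[ℝ] ℝ}

lemma IsCocompactCone.exists_ball (hC : IsSharpCone C h) (hK : IsCocompactCone C K) :
    ∃ r : ℝ, 0 < r ∧ ∀ k ∈ K, ∀ e : V, ‖e‖ < r → k + e ∈ C := by
  obtain ⟨r, hr, hrC⟩ := hK.isCompact.exists_thickening_subset_open hC.isOpen hK.subset
  refine ⟨r, hr, fun k hk e he => hrC ?_⟩
  rw [mem_thickening_iff]
  exact ⟨k, hk, by simpa [dist_eq_norm] using he⟩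

lemma IsCocompactCone.exists_bound (hK : IsCocompactCone C K) (f : V →L[ℝ] ℝ) :
    ∃ R : ℝ, 0 ≤ R ∧ ∀ k ∈ K, f k ≤ R := by
  obtain ⟨R, hR⟩ := (hK.isCompact.image f.continuous).bddAbove
  exact ⟨max R 0, le_max_right _ _, fun k hk => (hR ⟨k, hk, rfl⟩).trans (le_max_left _ _)⟩

lemma tendsto_continuousLinearMap_apply {E F α : Type*} [NormedAddCommGroup E] [NormedSpace ℝ E]
    [NormedAddCommGroup F] [NormedSpace ℝ F] {l : Filter α} {f : α → E →L[ℝ] F} {f₀ : E →L[ℝ] F}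
    (hf : Tendsto f l (nhds f₀)) {x : α → E} {x₀ : E} (hx : Tendsto x l (nhds x₀)) :
    Tendsto (fun n => f n (x n)) l (nhds (f₀ x₀)) :=
  (isBoundedBilinearMap_apply.continuous.tendsto (f₀, x₀)).comp (hf.prodMk_nhds hx)

/-- A linear projection `P` which maps `C` into `closure C` and is diagonal in a basis made of
vectors of `closure C` is trivial: rescaling `C` along `P` and using cocompactness, an
isomorphic copy of `C` would split. -/
lemma IsCocompactCone.projection_trivial [FiniteDimensional ℝ V] (hC : IsSharpCone C h)
    (hK : IsCocompactCone C K) (hI : IsIndecomposableCone C) {κ : Type*} [Fintype κ] (b : Module.Basis κ ℝ V)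
    (hb : ∀ i, b i ∈ closure C) (P : V →L[ℝ] V) (hPP : ∀ p, P (P p) = P p)
    (hPb : ∀ i, P (b i) = 0 ∨ P (b i) = b i) (hPC : ∀ p ∈ C, P p ∈ closure C) :
    (∀ p, P p = 0) ∨ ∀ p, P p = p := by
  classical
  obtain ⟨r, hr, hball⟩ := hK.exists_ball hC
  obtain ⟨R, hR0, hR⟩ := hK.exists_bound h
  let δ : ℕ → ℝ := fun n => 1 / ((n : ℝ) + 1)
  have hδ0 : ∀ n, 0 < δ n := fun n => Nat.one_div_pos_of_nat
  have hδ1 : ∀ n, δ n ≤ 1 := fun n => by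
    rw [div_le_one (by positivity)]; linarith [n.cast_nonneg (α := ℝ)]
  have hδlim : Tendsto δ atTop (nhds 0) := tendsto_one_div_add_atTop_nhds_zero_nat
  let D : ℕ → V →L[ℝ] V := fun n => δ n • P + (ContinuousLinearMap.id ℝ V - P)
  let D' : ℕ → V →L[ℝ] V := fun n => (δ n)⁻¹ • P + (ContinuousLinearMap.id ℝ V - P)
  have hD : ∀ n p, D n p = δ n • P p + (p - P p) := fun n p => rfl
  have hD' : ∀ n p, D' n p = (δ n)⁻¹ • P p + (p - P p) := fun n p => rfl
  have hDD' : ∀ n p, D n (D' n p) = p := fun n p => by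
    simp [hD, hD', hPP, smul_smul, (hδ0 n).ne']
  have hD'D : ∀ n p, D' n (D n p) = p := fun n p => by
    simp [hD, hD', hPP, smul_smul, (hδ0 n).ne']
  have hDb : ∀ n i, D n (b i) ∈ closure C := fun n i => by
    rcases hPb i with h0 | h1
    · simpa [hD, h0] using hb i
    · simpa [hD, h1] using hC.closure_smul_mem (hδ0 n) (hb i)
  have hD'C : ∀ n, ∀ p ∈ C, D' n p ∈ C := fun n p hp => by
    have h1 : D' n p = p + ((δ n)⁻¹ - 1) • P p := by rw [hD', sub_smul, one_smul]; abel
    rw [h1]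
    exact hC.add_closure_mem hp (hC.closure_smul_mem_of_nonneg
      (sub_nonneg.2 ((one_le_inv₀ (hδ0 n)).2 (hδ1 n))) (hPC p hp))
  let u : V := ∑ i, (1 : ℝ) • b i
  have hDu : ∀ n, D n u ∈ C := fun n => by
    let c : κ → ℝ := fun i => if P (b i) = 0 then 1 else δ n
    have h1 : D n u = ∑ i, c i • b i := by
      simp only [u, map_sum, one_smul]
      refine Finset.sum_congr rfl fun i _ => ?_
      by_cases h0 : P (b i) = 0
      · simp [hD, c, h0]
      · have h2 := (hPb i).resolve_left h0
        simp only [hD, c, h0, if_false]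
        simp [h2]
    rw [h1]
    refine hC.basis_sum_mem b hb fun i => ?_
    by_cases h0 : P (b i) = 0
    · simp [c, h0]
    · simpa [c, h0] using hδ0 n
  choose g hgC hgK using fun n => hK.exists_map_mem (D n u) (hDu n)
  let A : ℕ → V →L[ℝ] V := fun n => (g n : V →L[ℝ] V).comp (D n)
  let B : ℕ → V →L[ℝ] V := fun n => (D' n).comp ((g n).symm : V →L[ℝ] V)
  have hA : ∀ n p, A n p = g n (D n p) := fun n p => rfl
  have hB : ∀ n p, B n p = D' n ((g n).symm p) := fun n p => rfl
  have hAB : ∀ n p, A n (B n p) = p := fun n p => by simp [hA, hB, hDD']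
  have hBA : ∀ n p, B n (A n p) = p := fun n p => by simp [hA, hB, hD'D]
  obtain ⟨c, hc, hop⟩ := b.exists_opNorm_le (F := V)
  have hAbd : ∀ n, ‖A n‖ ≤ c * R := fun n => by
    refine hop hR0 fun i => ?_
    have hi : ∀ j, A n (b j) ∈ closure C := fun j => IsSharpCone.map_closure (hgC n) (hDb n j)
    refine (hC.norm_le_of_sub_mem (hi i) (q := A n u) ?_).trans (hR _ (hgK n))
    have : A n u - A n (b i) = ∑ j ∈ Finset.univ.erase i, A n (b j) := by
      simp only [u, map_sum, one_smul]
      rw [← Finset.add_sum_erase _ _ (Finset.mem_univ i), add_sub_cancel_left]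
    rw [this]
    exact hC.closure_sum_mem _ fun j _ => hi j
  have hBC : ∀ n, ∀ p ∈ C, B n p ∈ C := fun n p hp =>
    hD'C n _ ((hgC n _).1 (by simpa using hp))
  have hu0 : 0 ≤ h u := hC.nonneg_closure (hC.closure_sum_mem _ fun i _ => by simpa using hb i)
  have hBsmall : ∀ n e, ‖e‖ < r → ‖B n e‖ ≤ h u := fun n e he => by
    have h1 := hC.norm_le (hBC n _ (hball _ (hgK n) e he))
    have h2 := hC.norm_le (hBC n _ (hball _ (hgK n) (-e) (by simpa using he)))
    have h3 : B n (g n (D n u)) = u := hBA n u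
    rw [map_add, h3, map_add] at h1
    rw [map_add, h3, map_add, map_neg, map_neg] at h2
    have h4 : ‖(u + B n e) - (u + -B n e)‖ ≤ ‖u + B n e‖ + ‖u + -B n e‖ := norm_sub_le _ _
    have h5 : (u + B n e) - (u + -B n e) = (2 : ℝ) • B n e := by rw [two_smul]; abel
    rw [h5, norm_smul, Real.norm_ofNat] at h4
    linarith
  let M : ℝ := ∑ i, (2 * (‖b i‖ + 1) / r) * h u
  have hMi : ∀ i, 0 ≤ (2 * (‖b i‖ + 1) / r) * h u := fun i => by positivity
  have hBbd : ∀ n, ‖B n‖ ≤ c * M := fun n => by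
    refine hop (Finset.sum_nonneg fun i _ => hMi i) fun i => ?_
    refine le_trans ?_ (Finset.single_le_sum (fun j _ => hMi j) (Finset.mem_univ i))
    have hpos : 0 < 2 * (‖b i‖ + 1) / r := by positivity
    have h1 := hBsmall n ((2 * (‖b i‖ + 1) / r)⁻¹ • b i) (by
      rw [norm_smul, norm_inv, Real.norm_of_nonneg hpos.le, inv_div, div_mul_eq_mul_div,
        div_lt_iff₀ (by positivity)]
      nlinarith [norm_nonneg (b i)])
    rw [map_smul, norm_smul, norm_inv, Real.norm_of_nonneg hpos.le, inv_mul_le_iff₀ hpos] at h1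
    exact h1
  have : ProperSpace (V →L[ℝ] V) := FiniteDimensional.proper ℝ _
  let U : Ultrafilter ℕ := hyperfilter ℕ
  obtain ⟨A', hA'⟩ := exists_tendsto_ultrafilter_of_norm_le U A _ (.of_forall hAbd)
  obtain ⟨B', hB'⟩ := exists_tendsto_ultrafilter_of_norm_le U B _ (.of_forall hBbd)
  have hUle : (U : Filter ℕ) ≤ atTop := Nat.hyperfilter_le_atTop
  have hAp : ∀ p, Tendsto (fun n => A n p) U (nhds (A' p)) := fun p =>
    tendsto_continuousLinearMap_apply hA' tendsto_const_nhds
  have hBp : ∀ p, Tendsto (fun n => B n p) U (nhds (B' p)) := fun p =>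
    tendsto_continuousLinearMap_apply hB' tendsto_const_nhds
  have hA'B' : ∀ p, A' (B' p) = p := fun p =>
    tendsto_nhds_unique (tendsto_continuousLinearMap_apply hA' (hBp p)) (by simp [hAB])
  have hB'A' : ∀ p, B' (A' p) = p := fun p =>
    tendsto_nhds_unique (tendsto_continuousLinearMap_apply hB' (hAp p)) (by simp [hBA])
  have hPBn : ∀ n p, P (B n p) = (δ n)⁻¹ • P ((g n).symm p) := fun n p => by
    simp [hB, hD', hPP]
  have hsymm : ∀ n, ∀ p ∈ C, (g n).symm p ∈ C := fun n p hp => (hgC n _).1 (by simpa using hp)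
  have hPB : ∀ p ∈ C, P (B' p) ∈ closure C := fun p hp =>
    isClosed_closure.mem_of_tendsto ((P.continuous.tendsto _).comp (hBp p))
      (Eventually.of_forall fun n => by
        simp only [Function.comp, hPBn]
        exact hC.closure_smul_mem (inv_pos.2 (hδ0 n)) (hPC _ (hsymm n p hp)))
  have hQB : ∀ p ∈ C, B' p - P (B' p) ∈ closure C := fun p hp => by
    have h1 : Tendsto (fun n => (B n p - P (B n p)) + δ n • P (B n p)) U
        (nhds ((B' p - P (B' p)) + (0 : ℝ) • P (B' p))) :=
      ((hBp p).sub ((P.continuous.tendsto _).comp (hBp p))).add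
        ((hδlim.mono_left hUle).smul ((P.continuous.tendsto _).comp (hBp p)))
    rw [zero_smul, add_zero] at h1
    refine isClosed_closure.mem_of_tendsto h1 (Eventually.of_forall fun n => subset_closure ?_)
    have h2 : (B n p - P (B n p)) + δ n • P (B n p) = (g n).symm p := by
      rw [add_comm, ← hD, hB, hDD']
    rw [h2]
    exact hsymm n p hp
  have hAcl : ∀ e, P e ∈ closure C → e - P e ∈ closure C → A' e ∈ closure C := fun e h1 h2 =>
    isClosed_closure.mem_of_tendsto (hAp e) (Eventually.of_forall fun n =>
      IsSharpCone.map_closure (hgC n)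
        (hC.closure_add_mem (hC.closure_smul_mem (hδ0 n) h1) h2))
  let Q : V →L[ℝ] V := A'.comp (P.comp B')
  have hQ : ∀ p, Q p = A' (P (B' p)) := fun p => rfl
  have hQ' : ∀ p, p - Q p = A' (B' p - P (B' p)) := fun p => by rw [map_sub, hA'B', hQ]
  have hQC : ∀ p ∈ C, Q p ∈ closure C ∧ p - Q p ∈ closure C := fun p hp => by
    rw [hQ', hQ]
    refine ⟨hAcl _ ?_ ?_, hAcl _ ?_ ?_⟩
    · rw [hPP]; exact hPB p hp
    · rw [hPP, sub_self]; exact hC.zero_mem_closure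
    · rw [map_sub, hPP, sub_self]; exact hC.zero_mem_closure
    · rw [map_sub, hPP, sub_self, sub_zero]; exact hQB p hp
  rcases hI Q (fun p => by simp [hQ, hB'A', hPP]) hQC with h0 | h1
  · refine Or.inl fun p => ?_
    have := congrArg B' (h0 (A' p))
    simpa [hQ, hB'A'] using this
  · refine Or.inr fun p => ?_
    have := congrArg B' (h1 (A' p))
    simpa [hQ, hB'A'] using this

end Rescaling

/-! ### Simplicial cones of codimension one -/

section ConeFlats

variable {V : Type*} [NormedAddCommGroup V] [NormedSpace ℝ V]
  {ι : Type*} [Fintype ι]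

/-- The map `p ↦ ∑ j, φ j p • v j`: the projection onto the span of `v` when `φ` is dual to `v`. -/
def simplexProj (v : ι → V) (φ : ι → V →L[ℝ] ℝ) : V →L[ℝ] V := ∑ j, (φ j).smulRight (v j)

lemma simplexProj_apply (v : ι → V) (φ : ι → V →L[ℝ] ℝ) (p : V) :
    simplexProj v φ p = ∑ j, φ j p • v j := by
  simp [simplexProj]

/-- The vectors `v` span a simplicial cone whose relative interior lies in `C`, and each of whose
facets is supported by one of the functionals `φ`, dual to `v`. -/
structure IsConeFlat [DecidableEq ι] (C : Set V) (v : ι → V) (φ : ι → V →L[ℝ] ℝ) : Prop where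
  mem : ∀ j, v j ∈ closure C
  nonneg : ∀ j, ∀ p ∈ C, 0 ≤ φ j p
  dual : ∀ j k, φ j (v k) = if j = k then 1 else 0
  exists_mem : ∃ o ∈ C, simplexProj v φ o = o

/-- Points within bounded Hilbert distance of the simplicial cone spanned by `w`. -/
def nearSet (C : Set V) (M : ℝ) (w : ι → V) (ψ : ι → V →L[ℝ] ℝ) : Set V :=
  {p | ∃ y, simplexProj w ψ y = y ∧ y - p ∈ C ∧ M • p - y ∈ C}

namespace IsConeFlat

variable [DecidableEq ι] {C K : Set V} {h : V →L[ℝ] ℝ} {v : ι → V} {φ : ι → V →L[ℝ] ℝ}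

lemma pos (hC : IsSharpCone C h) (hv : IsConeFlat C v φ) (j : ι) {p : V} (hp : p ∈ C) :
    0 < φ j p :=
  hC.functional_pos (hv.nonneg j) (e := v j) (by simp [hv.dual]) hp

lemma nonneg_closure (hv : IsConeFlat C v φ) (j : ι) {p : V} (hp : p ∈ closure C) :
    0 ≤ φ j p :=
  IsSharpCone.functional_nonneg_closure (hv.nonneg j) hp

lemma ne_zero (hv : IsConeFlat C v φ) (j : ι) : v j ≠ 0 := fun h0 => by
  have := hv.dual j j
  simp [h0] at this

lemma simplexProj_vertex (hv : IsConeFlat C v φ) (k : ι) : simplexProj v φ (v k) = v k := by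
  simp [simplexProj_apply, hv.dual]

lemma simplexProj_idem (hv : IsConeFlat C v φ) (p : V) :
    simplexProj v φ (simplexProj v φ p) = simplexProj v φ p := by
  simp [simplexProj_apply v φ p, hv.simplexProj_vertex]

lemma apply_sum (hv : IsConeFlat C v φ) (c : ι → ℝ) (j : ι) : φ j (∑ k, c k • v k) = c j := by
  simp [hv.dual]

lemma linearIndependent (hv : IsConeFlat C v φ) : LinearIndependent ℝ v := by
  rw [Fintype.linearIndependent_iff]
  intro c hc j
  rw [← hv.apply_sum c j, hc, map_zero]

lemma simplexProj_eq_iff (hv : IsConeFlat C v φ) {p : V} :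
    simplexProj v φ p = p ↔ p ∈ Submodule.span ℝ (range v) := by
  constructor
  · intro hp
    rw [← hp, simplexProj_apply]
    exact Submodule.sum_mem _ fun j _ =>
      Submodule.smul_mem _ _ (Submodule.subset_span (mem_range_self j))
  · intro hp
    induction hp using Submodule.span_induction with
    | mem x hx => obtain ⟨j, rfl⟩ := hx; exact hv.simplexProj_vertex j
    | zero => simp
    | add x y _ _ hx hy => rw [map_add, hx, hy]
    | smul t x _ hx => rw [map_smul, hx]

lemma simplexProj_mem_closure (hC : IsSharpCone C h) (hv : IsConeFlat C v φ) {p : V}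
    (hp : ∀ j, 0 ≤ φ j p) : simplexProj v φ p ∈ closure C := by
  rw [simplexProj_apply]
  exact hC.closure_sum_mem _ fun j _ => hC.closure_smul_mem_of_nonneg (hp j) (hv.mem j)

/-- Points of the span with positive coordinates lie in `C`. -/
lemma mem_of_pos (hC : IsSharpCone C h) (hv : IsConeFlat C v φ) {p : V}
    (hp : ∀ j, 0 < φ j p) (hpT : simplexProj v φ p = p) : p ∈ C := by
  obtain ⟨o, ho, hoT⟩ := hv.exists_mem
  have hev : ∀ᶠ t : ℝ in nhdsWithin 0 (Ioi 0), ∀ j, 0 < φ j (p - t • o) := by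
    rw [eventually_all]
    intro j
    have ht : Tendsto (fun t : ℝ => φ j (p - t • o)) (nhdsWithin 0 (Ioi 0))
        (nhds (φ j (p - (0 : ℝ) • o))) :=
      (((φ j).continuous.comp (continuous_const.sub
        (continuous_id.smul continuous_const))).tendsto (0 : ℝ)).mono_left nhdsWithin_le_nhds
    rw [zero_smul, sub_zero] at ht
    exact ht.eventually (lt_mem_nhds (hp j))
  obtain ⟨t, htp, ht0⟩ := (hev.and self_mem_nhdsWithin).exists
  have h1 := hv.simplexProj_mem_closure hC (p := p - t • o) fun j => (htp j).le
  rw [map_sub, map_smul, hpT, hoT] at h1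
  have h2 := hC.add_closure_mem (hC.smul_mem ht0 ho) h1
  simpa using h2

lemma exists_basis [FiniteDimensional ℝ V] (hv : IsConeFlat C v φ)
    (hcard : Module.finrank ℝ V = Fintype.card ι + 1) {p : V} (hp : simplexProj v φ p ≠ p) :
    ∃ b : Module.Basis (Option ι) ℝ V, (∀ j, b (some j) = v j) ∧ b none = p := by
  have hli : LinearIndependent ℝ (fun o : Option ι => o.elim p v) :=
    linearIndependent_option.2 ⟨hv.linearIndependent, fun hps => hp (hv.simplexProj_eq_iff.2 hps)⟩
  refine ⟨basisOfLinearIndependentOfCardEqFinrank hli (by simp [hcard]), fun j => ?_, ?_⟩ <;> simp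

/-- A point of `closure C` on one of the supporting hyperplanes of the facets of a flat lies in the
span of the flat. -/
lemma simplexProj_eq_of_apply_eq_zero [FiniteDimensional ℝ V] (hC : IsSharpCone C h)
    (hK : IsCocompactCone C K) (hI : IsIndecomposableCone C) (hv : IsConeFlat C v φ)
    (hcard : Module.finrank ℝ V = Fintype.card ι + 1) {j : ι} {p : V} (hp : p ∈ closure C)
    (hj : φ j p = 0) : simplexProj v φ p = p := by
  by_contra hne
  obtain ⟨b, hbs, hbn⟩ := hv.exists_basis hcard hne
  rcases hK.projection_trivial hC hI b (P := (φ j).smulRight (v j))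
      (by rintro (_ | i) <;> simp only [hbs, hbn]; exacts [hp, hv.mem i])
      (fun x => by simp [hv.dual])
      (by
        rintro (_ | i)
        · left; simp [hbn, hj]
        · by_cases hij : j = i
          · subst hij; right; simp [hbs, hv.dual]
          · left; simp [hbs, hv.dual, hij])
      (fun x hx => hC.closure_smul_mem_of_nonneg (hv.nonneg j x hx) (hv.mem j)) with h0 | h1
  · exact hv.ne_zero j (by simpa [hv.dual] using h0 (v j))
  · have : p = 0 := by simpa [hj] using (h1 p).symm
    exact hne (by simp [this])

/-- The image of a flat under a linear automorphism of the cone, with vertices normalized so that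
`h` takes the value one. -/
lemma map (hC : IsSharpCone C h) (hv : IsConeFlat C v φ) {g : V ≃L[ℝ] V}
    (hg : ∀ p, g p ∈ C ↔ p ∈ C) :
    IsConeFlat C (fun j => (h (g (v j)))⁻¹ • g (v j))
      (fun j => h (g (v j)) • (φ j).comp (g.symm : V →L[ℝ] V)) ∧
    ∀ p, simplexProj (fun j => (h (g (v j)))⁻¹ • g (v j))
      (fun j => h (g (v j)) • (φ j).comp (g.symm : V →L[ℝ] V)) p =
      g (simplexProj v φ (g.symm p)) := by
  have hpos : ∀ j, 0 < h (g (v j)) := fun j =>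
    hC.pos_of_ne_zero (IsSharpCone.map_closure hg (hv.mem j))
      (by simpa using hv.ne_zero j)
  have hT : ∀ p, simplexProj (fun j => (h (g (v j)))⁻¹ • g (v j))
      (fun j => h (g (v j)) • (φ j).comp (g.symm : V →L[ℝ] V)) p =
      g (simplexProj v φ (g.symm p)) := fun p => by
    simp only [simplexProj_apply, map_sum, map_smul]
    refine Finset.sum_congr rfl fun j _ => ?_
    simp only [smul_apply, ContinuousLinearMap.comp_apply, smul_smul,
      smul_eq_mul, ContinuousLinearEquiv.coe_coe]
    rw [mul_right_comm, mul_inv_cancel₀ (hpos j).ne', one_mul]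
  refine ⟨⟨fun j => ?_, fun j p hp => ?_, fun j k => ?_, ?_⟩, hT⟩
  · exact hC.closure_smul_mem (inv_pos.2 (hpos j)) (IsSharpCone.map_closure hg (hv.mem j))
  · exact mul_nonneg (hpos j).le (hv.nonneg j _ ((hg _).1 (by simpa using hp)))
  · by_cases hjk : j = k
    · subst hjk; simp [hv.dual, (hpos j).ne']
    · simp [hv.dual, hjk]
  · obtain ⟨o, ho, hoT⟩ := hv.exists_mem
    exact ⟨g o, (hg o).2 ho, by rw [hT]; simp [hoT]⟩

lemma apply_le (hv : IsConeFlat C v φ) (hnorm : ∀ j, h (v j) = 1) (j : ι)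
    {p : V} (hp : p ∈ C) (hpT : simplexProj v φ p = p) : φ j p ≤ h p := by
  have h1 : h p = ∑ k, φ k p := by
    conv_lhs => rw [← hpT, simplexProj_apply]
    simp [hnorm]
  rw [h1]
  exact Finset.single_le_sum (fun k _ => hv.nonneg k p hp) (Finset.mem_univ j)

end IsConeFlat

lemma tendsto_simplexProj {α : Type*} {l : Filter α} {v : α → ι → V} {φ : α → ι → V →L[ℝ] ℝ}
    {v' : ι → V} {φ' : ι → V →L[ℝ] ℝ} (hv : ∀ j, Tendsto (fun n => v n j) l (nhds (v' j)))
    (hφ : ∀ j, Tendsto (fun n => φ n j) l (nhds (φ' j))) {p : α → V} {p' : V}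
    (hp : Tendsto p l (nhds p')) :
    Tendsto (fun n => simplexProj (v n) (φ n) (p n)) l (nhds (simplexProj v' φ' p')) := by
  simp only [simplexProj_apply]
  exact tendsto_finsetSum _ fun j _ => (tendsto_continuousLinearMap_apply (hφ j) hp).smul (hv j)

/-- Compactness: normalized flats through points staying in a compact part of `C` converge to
a flat. -/
lemma exists_limit_coneFlat [FiniteDimensional ℝ V] [DecidableEq ι] {C : Set V} {h : V →L[ℝ] ℝ}
    (hC : IsSharpCone C h) {α : Type*} (U : Ultrafilter α) {v : α → ι → V}
    {φ : α → ι → V →L[ℝ] ℝ} (hv : ∀ n, IsConeFlat C (v n) (φ n)) (hnorm : ∀ n j, h (v n j) = 1)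
    {p : α → V} {p' : V} (hp : ∀ n, p n ∈ C) (hpT : ∀ n, simplexProj (v n) (φ n) (p n) = p n)
    {r R : ℝ} (hr : 0 < r) (hball : ∀ n e, ‖e‖ < r → p n + e ∈ C) (hR : ∀ n, h (p n) ≤ R)
    (hlim : Tendsto p U (nhds p')) :
    ∃ (v' : ι → V) (φ' : ι → V →L[ℝ] ℝ), (∀ j, Tendsto (fun n => v n j) U (nhds (v' j))) ∧
      (∀ j, Tendsto (fun n => φ n j) U (nhds (φ' j))) ∧ IsConeFlat C v' φ' ∧ p' ∈ C ∧
      simplexProj v' φ' p' = p' := by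
  have : ProperSpace V := FiniteDimensional.proper ℝ _
  have : ProperSpace (V →L[ℝ] ℝ) := FiniteDimensional.proper ℝ _
  have hφbd : ∀ j n, ‖φ n j‖ ≤ 2 / r * R := fun j n => by
    have hle : φ n j (p n) ≤ R := ((hv n).apply_le (hnorm n) j (hp n) (hpT n)).trans (hR n)
    have hR0 : 0 ≤ R := ((hv n).nonneg j _ (hp n)).trans hle
    refine ContinuousLinearMap.opNorm_le_bound _ (by positivity) fun x => ?_
    rcases eq_or_ne x 0 with rfl | hx
    · simp
    have hx0 : 0 < ‖x‖ := norm_pos_iff.2 hx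
    have hs : 0 < r / (2 * ‖x‖) := by positivity
    have hsm : ‖(r / (2 * ‖x‖)) • x‖ < r := by
      rw [norm_smul, Real.norm_of_nonneg hs.le]
      field_simp
      linarith
    have h1 := (hv n).nonneg j _ (hball n _ hsm)
    have h2 := (hv n).nonneg j _ (hball n (-((r / (2 * ‖x‖)) • x)) (by rwa [norm_neg]))
    rw [map_add, map_smul, smul_eq_mul] at h1
    rw [map_add, map_neg, map_smul, smul_eq_mul] at h2
    have h3 : |r / (2 * ‖x‖) * φ n j x| ≤ R := abs_le.2 ⟨by linarith, by linarith⟩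
    rw [abs_mul, abs_of_pos hs, ← le_div_iff₀' hs] at h3
    rw [Real.norm_eq_abs]
    refine h3.trans (le_of_eq ?_)
    field_simp
  choose v' hv' using fun j => exists_tendsto_ultrafilter_of_norm_le U (fun n => v n j) 1
    (.of_forall fun n => (hC.norm_le_closure ((hv n).mem j)).trans (hnorm n j).le)
  choose φ' hφ' using fun j => exists_tendsto_ultrafilter_of_norm_le U (fun n => φ n j) _
    (.of_forall (hφbd j))
  have hp' : p' ∈ C := by
    have h1 : ∀ᶠ n in (U : Filter α), ‖p' - p n‖ < r := by
      have h2 : Tendsto (fun n => ‖p' - p n‖) U (nhds ‖p' - p'‖) := (tendsto_const_nhds.sub hlim).norm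
      rw [sub_self, norm_zero] at h2
      exact h2.eventually (gt_mem_nhds hr)
    obtain ⟨n, hn⟩ := h1.exists
    simpa using hball n _ hn
  have hpT' : simplexProj v' φ' p' = p' :=
    tendsto_nhds_unique (tendsto_simplexProj hv' hφ' hlim) (by simpa only [hpT] using hlim)
  refine ⟨v', φ', hv', hφ', ⟨fun j => ?_, fun j q hq => ?_, fun j k => ?_, p', hp', hpT'⟩, hp',
    hpT'⟩
  · exact isClosed_closure.mem_of_tendsto (hv' j) (Eventually.of_forall fun n => (hv n).mem j)
  · exact ge_of_tendsto (tendsto_continuousLinearMap_apply (hφ' j) tendsto_const_nhds)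
      (Eventually.of_forall fun n => (hv n).nonneg j q hq)
  · exact tendsto_nhds_unique (tendsto_continuousLinearMap_apply (hφ' j) (hv' k))
      (by simp only [(hv _).dual]; exact tendsto_const_nhds)

end ConeFlats

/-! ### Pairs of flats at bounded distance -/

section NearFlats

variable {V : Type*} [NormedAddCommGroup V] [NormedSpace ℝ V] [FiniteDimensional ℝ V]
  {ι : Type*} [Fintype ι] [DecidableEq ι] {C K : Set V} {h : V →L[ℝ] ℝ}
  {v w : ι → V} {φ ψ : ι → V →L[ℝ] ℝ}

/-- If a sequence tending to the boundary of a flat stays near a second flat, then its limit lies in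
the span of both, as does every vertex needed to span the limit of the nearby points. -/
lemma limit_of_near_flat (hC : IsSharpCone C h) (hK : IsCocompactCone C K)
    (hI : IsIndecomposableCone C) (hcard : Module.finrank ℝ V = Fintype.card ι + 1)
    (hv : IsConeFlat C v φ) (hw : IsConeFlat C w ψ) {α : Type*} (U : Ultrafilter α)
    {p y : α → V} {M : ℝ} (hp : ∀ n, p n ∈ C) (hyT : ∀ n, simplexProj w ψ (y n) = y n)
    (hpy : ∀ n, y n - p n ∈ C) (hyp : ∀ n, M • p n - y n ∈ C) {x : V} (hx : Tendsto p U (nhds x))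
    {j : ι} (hj : φ j x = 0) :
    simplexProj w ψ x = x ∧ ∃ y', Tendsto y U (nhds y') ∧
      ∀ k, ψ k y' = 0 ∨ simplexProj v φ (w k) = w k := by
  have : ProperSpace V := FiniteDimensional.proper ℝ _
  have hyC : ∀ n, y n ∈ C := fun n => by simpa using hC.add_mem (hpy n) (hp n)
  have hbd : ∀ᶠ n in (U : Filter α), ‖y n‖ ≤ h (M • x) + 1 := by
    have h1 : Tendsto (fun n => h (M • p n)) U (nhds (h (M • x))) :=
      (h.continuous.tendsto _).comp (hx.const_smul M)
    filter_upwards [h1.eventually (gt_mem_nhds (lt_add_one _))] with n hn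
    exact (hC.norm_le_of_sub_mem (subset_closure (hyC n)) (subset_closure (hyp n))).trans hn.le
  obtain ⟨y', hy'⟩ := exists_tendsto_ultrafilter_of_norm_le U y _ hbd
  have hxcl : x ∈ closure C :=
    isClosed_closure.mem_of_tendsto hx (.of_forall fun n => subset_closure (hp n))
  have hycl : y' ∈ closure C :=
    isClosed_closure.mem_of_tendsto hy' (.of_forall fun n => subset_closure (hyC n))
  have hxy : y' - x ∈ closure C :=
    isClosed_closure.mem_of_tendsto (hy'.sub hx) (.of_forall fun n => subset_closure (hpy n))
  have hyx : M • x - y' ∈ closure C :=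
    isClosed_closure.mem_of_tendsto ((hx.const_smul M).sub hy')
      (.of_forall fun n => subset_closure (hyp n))
  have hyT' : simplexProj w ψ y' = y' :=
    tendsto_nhds_unique (((simplexProj w ψ).continuous.tendsto _).comp hy')
      (by simpa only [Function.comp_def, hyT] using hy')
  have hjy : φ j y' = 0 := by
    have h1 := hv.nonneg_closure j hyx
    rw [map_sub, map_smul, hj, smul_zero] at h1
    linarith [hv.nonneg_closure j hycl]
  refine ⟨?_, y', hy', fun k => ?_⟩
  · obtain ⟨k, hk⟩ : ∃ k, ψ k y' = 0 := by
      by_contra! hne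
      have h1 := hw.mem_of_pos hC (fun k => (hw.nonneg_closure k hycl).lt_of_ne' (hne k)) hyT'
      exact (hv.pos hC j h1).ne' hjy
    refine hw.simplexProj_eq_of_apply_eq_zero hC hK hI hcard hxcl (j := k) ?_
    have h1 := hw.nonneg_closure k hxy
    rw [map_sub, hk] at h1
    linarith [hw.nonneg_closure k hxcl]
  · refine or_iff_not_imp_left.2 fun hk => ?_
    refine hv.simplexProj_eq_of_apply_eq_zero hC hK hI hcard (hw.mem k) (j := j) ?_
    have hk0 : 0 < ψ k y' := (hw.nonneg_closure k hycl).lt_of_ne' hk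
    have h1 : y' - ψ k y' • w k ∈ closure C := by
      have h2 : y' - ψ k y' • w k = ∑ i ∈ Finset.univ.erase k, ψ i y' • w i := by
        have h3 : ψ k y' • w k + ∑ i ∈ Finset.univ.erase k, ψ i y' • w i = y' := by
          rw [Finset.add_sum_erase _ (fun i => ψ i y' • w i) (Finset.mem_univ k),
            ← simplexProj_apply, hyT']
        exact sub_eq_of_eq_add' h3.symm
      rw [h2]
      exact hC.closure_sum_mem _ fun i _ =>
        hC.closure_smul_mem_of_nonneg (hw.nonneg_closure i hycl) (hw.mem i)
    have h3 := hv.nonneg_closure j h1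
    rw [map_sub, hjy, map_smul, smul_eq_mul] at h3
    have h4 := hv.nonneg_closure j (hw.mem k)
    nlinarith

/-- A sequence in a flat tending to its boundary cannot stay at bounded distance from a second flat
without coming arbitrarily close to it. -/
lemma eventually_mem_nearSet (hC : IsSharpCone C h) (hK : IsCocompactCone C K)
    (hI : IsIndecomposableCone C) (hcard : Module.finrank ℝ V = Fintype.card ι + 1)
    (hv : IsConeFlat C v φ) (hw : IsConeFlat C w ψ) {α : Type*} (U : Ultrafilter α)
    {p : α → V} {M M' : ℝ} (hM : 1 < M) (hp : ∀ n, p n ∈ C)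
    (hpT : ∀ n, simplexProj v φ (p n) = p n) (hnear : ∀ n, p n ∈ nearSet C M' w ψ)
    {x : V} (hx : Tendsto p U (nhds x)) (hx0 : x ≠ 0) {j : ι} (hj : φ j x = 0) :
    ∃ n, p n ∈ nearSet C M w ψ := by
  have : ProperSpace V := FiniteDimensional.proper ℝ _
  choose q hqT hpq hqp using hnear
  obtain ⟨-, q', hq', hqw⟩ := limit_of_near_flat hC hK hI hcard hv hw U hp hqT hpq hqp hx hj
  choose g hgC hgK using fun n => hK.exists_map_mem (p n) (hp n)
  obtain ⟨r, hr, hball⟩ := hK.exists_ball hC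
  obtain ⟨R, hR0, hR⟩ := hK.exists_bound h
  -- the translated flats and their limits
  let vn : α → ι → V := fun n j => (h (g n (v j)))⁻¹ • g n (v j)
  let φn : α → ι → V →L[ℝ] ℝ := fun n j =>
    h (g n (v j)) • (φ j).comp ((g n).symm : V →L[ℝ] V)
  let wn : α → ι → V := fun n j => (h (g n (w j)))⁻¹ • g n (w j)
  let ψn : α → ι → V →L[ℝ] ℝ := fun n j =>
    h (g n (w j)) • (ψ j).comp ((g n).symm : V →L[ℝ] V)
  have hvn : ∀ n, IsConeFlat C (vn n) (φn n) := fun n => (hv.map hC (hgC n)).1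
  have hvT : ∀ n p, simplexProj (vn n) (φn n) p = g n (simplexProj v φ ((g n).symm p)) :=
    fun n => (hv.map hC (hgC n)).2
  have hwn : ∀ n, IsConeFlat C (wn n) (ψn n) := fun n => (hw.map hC (hgC n)).1
  have hwT : ∀ n p, simplexProj (wn n) (ψn n) p = g n (simplexProj w ψ ((g n).symm p)) :=
    fun n => (hw.map hC (hgC n)).2
  have hvpos : ∀ n j, 0 < h (g n (v j)) := fun n j =>
    hC.pos_of_ne_zero (IsSharpCone.map_closure (hgC n) (hv.mem j)) (by simpa using hv.ne_zero j)
  have hwpos : ∀ n j, 0 < h (g n (w j)) := fun n j =>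
    hC.pos_of_ne_zero (IsSharpCone.map_closure (hgC n) (hw.mem j)) (by simpa using hw.ne_zero j)
  have hpR : ∀ n, h (g n (p n)) ≤ R := fun n => hR _ (hgK n)
  have hgp : ∀ n, g n (p n) ∈ C := fun n => hK.subset (hgK n)
  have hgq : ∀ n, g n (q n) - g n (p n) ∈ C := fun n => by
    rw [← map_sub]; exact (hgC n _).2 (hpq n)
  have hgqC : ∀ n, g n (q n) ∈ C := fun n => by simpa using hC.add_mem (hgq n) (hgp n)
  have hqR : ∀ n, h (g n (q n)) ≤ |M'| * R := fun n => by
    have h1 := hC.nonneg_closure (subset_closure ((hgC n _).2 (hqp n)))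
    rw [map_sub, map_sub, map_smul, map_smul, smul_eq_mul] at h1
    have h2 := hC.nonneg_closure (subset_closure (hgp n))
    have h3 := mul_le_mul (le_abs_self M') (hpR n) h2 (abs_nonneg _)
    linarith
  obtain ⟨p₁, hp₁⟩ := exists_tendsto_ultrafilter_of_norm_le U (fun n => g n (p n)) R
    (.of_forall fun n => (hC.norm_le (hgp n)).trans (hpR n))
  obtain ⟨q₁, hq₁⟩ := exists_tendsto_ultrafilter_of_norm_le U (fun n => g n (q n)) (|M'| * R)
    (.of_forall fun n => (hC.norm_le (hgqC n)).trans (hqR n))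
  obtain ⟨v', φ', hv', hφ', hvflat, hp₁C, hp₁T⟩ := exists_limit_coneFlat hC U hvn
    (fun n j => by simp [vn, (hvpos n j).ne']) hgp (fun n => by rw [hvT]; simp [hpT]) hr
    (fun n => hball _ (hgK n)) hpR hp₁
  obtain ⟨w', ψ', hw', hψ', hwflat, hq₁C, hq₁T⟩ := exists_limit_coneFlat hC U hwn
    (fun n j => by simp [wn, (hwpos n j).ne']) hgqC (fun n => by rw [hwT]; simp [hqT]) hr
    (fun n e he => by
      have := hC.add_mem (hgq n) (hball _ (hgK n) e he)
      rwa [← add_assoc, sub_add_cancel] at this) hqR hq₁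
  by_cases hspan : ∀ k, simplexProj v' φ' (w' k) = w' k
  · -- the limit flats coincide, so the second flat comes close to the sequence
    have hle : Submodule.span ℝ (range w') ≤ Submodule.span ℝ (range v') := by
      rw [Submodule.span_le]
      rintro _ ⟨k, rfl⟩
      exact hvflat.simplexProj_eq_iff.1 (hspan k)
    have heq := Submodule.eq_of_le_of_finrank_eq hle (by
      rw [finrank_span_eq_card hvflat.linearIndependent,
        finrank_span_eq_card hwflat.linearIndependent])
    have hp₁w : simplexProj w' ψ' p₁ = p₁ :=
      hwflat.simplexProj_eq_iff.2 (heq ▸ hvflat.simplexProj_eq_iff.1 hp₁T)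
    let t : ℝ := (1 + M) / 2
    have hlim : Tendsto (fun n => t • simplexProj (wn n) (ψn n) p₁) U (nhds (t • p₁)) := by
      have := (tendsto_simplexProj hw' hψ' (tendsto_const_nhds (x := p₁))).const_smul t
      rwa [hp₁w] at this
    have h1 : t • p₁ - p₁ ∈ C := by
      have : t • p₁ - p₁ = (t - 1) • p₁ := by rw [sub_smul, one_smul]
      rw [this]; exact hC.smul_mem (by simp only [t]; linarith) hp₁C
    have h2 : M • p₁ - t • p₁ ∈ C := by
      rw [← sub_smul]; exact hC.smul_mem (by simp only [t]; linarith) hp₁C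
    obtain ⟨n, hn1, hn2⟩ := (((hlim.sub hp₁).eventually (hC.isOpen.mem_nhds h1)).and
      (((hp₁.const_smul M).sub hlim).eventually (hC.isOpen.mem_nhds h2))).exists
    refine ⟨n, (g n).symm (t • simplexProj (wn n) (ψn n) p₁), ?_, ?_, ?_⟩
    · simp [hwT, hw.simplexProj_idem]
    · rw [← hgC n, map_sub, ContinuousLinearEquiv.apply_symm_apply]; exact hn1
    · rw [← hgC n, map_sub, map_smul, ContinuousLinearEquiv.apply_symm_apply]; exact hn2
  · -- otherwise the cone would split
    exfalso
    push Not at hspan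
    obtain ⟨k, hk⟩ := hspan
    have hk0 : ψ k q' = 0 := (hqw k).resolve_right fun hwk => hk
      (tendsto_nhds_unique (tendsto_simplexProj hv' hφ' (hw' k)) (by
        simpa [hvT, wn, hwk] using hw' k))
    have hDv : ∀ i, Tendsto (fun n => (h (g n (v i)))⁻¹) U (nhds (φ i x / φ' i p₁)) := fun i => by
      have h1 := ((((φ i).continuous.tendsto _).comp hx).div
        (tendsto_continuousLinearMap_apply (hφ' i) hp₁) (hvflat.pos hC i hp₁C).ne')
      refine h1.congr fun n => ?_
      have h2 := (hv.pos hC i (hp n)).ne'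
      have h3 := (hvpos n i).ne'
      simp [φn]
      field_simp
    have hDw : Tendsto (fun n => (h (g n (w k)))⁻¹) U (nhds 0) := by
      have h1 := ((((ψ k).continuous.tendsto _).comp hq').div
        (tendsto_continuousLinearMap_apply (hψ' k) hq₁) (hwflat.pos hC k hq₁C).ne')
      rw [hk0, zero_div] at h1
      refine h1.congr fun n => ?_
      have h2 := (hw.pos hC k ((hgC n _).1 (hgqC n))).ne'
      have h3 := (hwpos n k).ne'
      simp [ψn]
      field_simp
    obtain ⟨b, hbs, hbn⟩ := hvflat.exists_basis hcard hk
    let P : V →L[ℝ] V := LinearMap.toContinuousLinearMap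
      (b.constr ℝ fun o : Option ι => o.elim 0 fun i => if φ i x = 0 then 0 else v' i)
    have hPs : ∀ i, P (v' i) = if φ i x = 0 then 0 else v' i := fun i => by
      have h1 : P (b (some i)) = if φ i x = 0 then 0 else v' i := b.constr_basis ℝ _ (some i)
      rwa [hbs] at h1
    have hPn : P (w' k) = 0 := by
      have h1 : P (b none) = 0 := b.constr_basis ℝ _ none
      rwa [hbn] at h1
    have hsum : ∀ c, c = b.repr c none • w' k + ∑ i, b.repr c (some i) • v' i := fun c => by
      have h1 := (b.sum_repr c).symm
      rw [Fintype.sum_option, hbn] at h1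
      simpa only [hbs] using h1
    have hPapply : ∀ c : V, P c = ∑ i, b.repr c (some i) • P (v' i) := fun c => by
      conv_lhs => rw [hsum c]
      rw [map_add, map_smul, hPn, smul_zero, zero_add, map_sum]
      simp only [map_smul]
    have hPC : ∀ c ∈ C, P c ∈ closure C := fun c hc => by
      rw [hPapply]
      refine hC.closure_sum_mem _ fun i _ => ?_
      rw [hPs]
      split_ifs with hi
      · simpa using hC.zero_mem_closure
      refine hC.closure_smul_mem_of_nonneg ?_ (hvflat.mem i)
      let cn : α → V := fun n => b.repr c none • wn n k + ∑ i, b.repr c (some i) • vn n i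
      have hcn : Tendsto cn U (nhds c) := by
        rw [hsum c]
        exact ((hw' k).const_smul _).add (tendsto_finsetSum _ fun i _ => (hv' i).const_smul _)
      have hval : ∀ n, φ i ((g n).symm (cn n)) =
          b.repr c none * ((h (g n (w k)))⁻¹ * φ i (w k)) +
            b.repr c (some i) * (h (g n (v i)))⁻¹ := fun n => by
        simp [cn, wn, vn, hv.dual]
      have hlim : Tendsto (fun n => φ i ((g n).symm (cn n))) U
          (nhds (b.repr c none * (0 * φ i (w k)) +
            b.repr c (some i) * (φ i x / φ' i p₁))) := by
        simp only [hval]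
        exact ((hDw.mul_const _).const_mul _).add ((hDv i).const_mul _)
      have hnn := ge_of_tendsto hlim ((hcn.eventually (hC.isOpen.mem_nhds hc)).mono
        fun n hn => hv.nonneg i _ ((hgC n _).1 (by
          rw [ContinuousLinearEquiv.apply_symm_apply]; exact hn)))
      have hxcl : x ∈ closure C :=
        isClosed_closure.mem_of_tendsto hx (.of_forall fun n => subset_closure (hp n))
      have hxi : 0 < φ i x / φ' i p₁ :=
        div_pos ((hv.nonneg_closure i hxcl).lt_of_ne' hi) (hvflat.pos hC i hp₁C)
      rw [zero_mul, mul_zero, zero_add] at hnn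
      exact nonneg_of_mul_nonneg_left hnn hxi
    have hPb : ∀ o, P (b o) = 0 ∨ P (b o) = b o := by
      rintro (_ | i)
      · left; rw [hbn, hPn]
      · rw [hbs, hPs]
        split_ifs
        · exact Or.inl rfl
        · exact Or.inr rfl
    have hPP : ∀ c, P (P c) = P c := by
      have : P.comp P = P := by
        apply ContinuousLinearMap.coe_injective
        refine b.ext fun o => ?_
        rcases hPb o with h0 | h1
        · simp [h0]
        · simp [h1]
      exact fun c => congrArg (fun L : V →L[ℝ] V => L c) this
    have hxT : simplexProj v φ x = x :=
      tendsto_nhds_unique (((simplexProj v φ).continuous.tendsto _).comp hx)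
        (by simpa only [Function.comp_def, hpT] using hx)
    rcases hK.projection_trivial hC hI b (by
        rintro (_ | i)
        · rw [hbn]; exact hwflat.mem k
        · rw [hbs]; exact hvflat.mem i) P hPP hPb hPC with h0 | h1
    · refine hx0 ?_
      rw [← hxT, simplexProj_apply]
      refine Finset.sum_eq_zero fun i _ => ?_
      have h2 := hPs i
      rw [h0] at h2
      split_ifs at h2 with hi
      · rw [hi, zero_smul]
      · exact absurd h2.symm (hvflat.ne_zero i)
    · have h2 := h1 (w' k)
      rw [hPn] at h2
      exact hwflat.ne_zero k h2.symm

end NearFlats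

/-! ### Propagation along the boundary of a flat -/

section Propagation

variable {V : Type*} [NormedAddCommGroup V] [NormedSpace ℝ V]
  {ι : Type*} [Fintype ι] {C K : Set V} {h : V →L[ℝ] ℝ}
  {v w : ι → V} {φ ψ : ι → V →L[ℝ] ℝ} {M : ℝ}

lemma IsSharpCone.isOpen_nearSet (hC : IsSharpCone C h) : IsOpen (nearSet C M w ψ) := by
  have : nearSet C M w ψ = ⋃ y ∈ {y | simplexProj w ψ y = y},
      {p | y - p ∈ C} ∩ {p | M • p - y ∈ C} := by
    ext p; simp [nearSet, and_left_comm]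
  rw [this]
  exact isOpen_biUnion fun y _ => (hC.isOpen.preimage (by fun_prop)).inter
    (hC.isOpen.preimage (by fun_prop))

lemma IsSharpCone.smul_mem_nearSet (hC : IsSharpCone C h) {t : ℝ} (ht : 0 < t) {p : V}
    (hp : p ∈ nearSet C M w ψ) : t • p ∈ nearSet C M w ψ := by
  obtain ⟨y, hy, h1, h2⟩ := hp
  refine ⟨t • y, by rw [map_smul, hy], ?_, ?_⟩
  · rw [← smul_sub]; exact hC.smul_mem ht h1
  · rw [smul_comm, ← smul_sub]; exact hC.smul_mem ht h2

lemma IsSharpCone.mem_nearSet_of_mem_closure (hC : IsSharpCone C h) (hM : 0 < M) {p : V}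
    (hpC : p ∈ C) (hp : p ∈ closure (nearSet C M w ψ)) : p ∈ nearSet C (4 * M) w ψ := by
  have h1 : {x | (2 : ℝ) • x - p ∈ C} ∩ {x | (2 : ℝ) • p - x ∈ C} ∈ nhds p := by
    have h2 : (2 : ℝ) • p - p = p := by rw [two_smul, add_sub_cancel_right]
    refine ((hC.isOpen.preimage (by fun_prop)).inter
      (hC.isOpen.preimage (by fun_prop))).mem_nhds ⟨?_, ?_⟩ <;> simpa only [mem_preimage, h2]
  obtain ⟨x, ⟨hx1, hx2⟩, y, hy, hyx, hxy⟩ := mem_closure_iff_nhds.1 hp _ h1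
  refine ⟨(2 : ℝ) • y, by rw [map_smul, hy], ?_, ?_⟩
  · convert hC.add_mem (hC.smul_mem two_pos hyx) hx1 using 1
    module
  · convert hC.add_mem (hC.smul_mem two_pos hxy) (hC.smul_mem (mul_pos two_pos hM) hx2) using 1
    module

/-- The part of a flat within `ε` of one of its facets, measured by the functional `f`. -/
def collar (C : Set V) (h : V →L[ℝ] ℝ) (T : V →L[ℝ] V) (f : V →L[ℝ] ℝ) (ε : ℝ) : Set V :=
  {p | p ∈ C ∧ T p = p ∧ f p < ε * h p}

lemma IsSharpCone.convex_collar (hC : IsSharpCone C h) (T : V →L[ℝ] V) (f : V →L[ℝ] ℝ)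
    (ε : ℝ) : Convex ℝ (collar C h T f ε) := by
  rintro p ⟨hp, hpT, hpf⟩ q ⟨hq, hqT, hqf⟩ a b ha hb hab
  refine ⟨hC.convex hp hq ha hb hab, by simp only [map_add, map_smul, hpT, hqT], ?_⟩
  simp only [map_add, map_smul, smul_eq_mul]
  rcases ha.eq_or_lt with rfl | ha
  · rw [zero_add] at hab
    subst hab
    simpa using hqf
  · have h1 := mul_lt_mul_of_pos_left hpf ha
    have h2 := mul_le_mul_of_nonneg_left hqf.le hb
    linarith

variable [DecidableEq ι] [FiniteDimensional ℝ V]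

/-- Near a facet of a flat, the nearness to a second flat propagates. -/
lemma exists_collar_subset (hC : IsSharpCone C h) (hK : IsCocompactCone C K)
    (hI : IsIndecomposableCone C) (hcard : Module.finrank ℝ V = Fintype.card ι + 1)
    (hv : IsConeFlat C v φ) (hw : IsConeFlat C w ψ) (hM : 1 < M) (j : ι) :
    ∃ ε > 0, (collar C h (simplexProj v φ) (φ j) ε ∩ nearSet C M w ψ).Nonempty →
      collar C h (simplexProj v φ) (φ j) ε ⊆ nearSet C M w ψ := by
  have : ProperSpace V := FiniteDimensional.proper ℝ _
  by_contra! hcon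
  have hkey : ∀ n : ℕ, ∃ p ∈ C, simplexProj v φ p = p ∧ φ j p < 1 / ((n : ℝ) + 1) ∧ h p = 1 ∧
      p ∈ nearSet C (4 * M) w ψ ∧ p ∉ nearSet C M w ψ := fun n => by
    obtain ⟨hne, hns⟩ := hcon (1 / ((n : ℝ) + 1)) Nat.one_div_pos_of_nat
    obtain ⟨p, ⟨hp, hpT, hpj⟩, hpU, hpcl⟩ :
        ∃ p ∈ collar C h (simplexProj v φ) (φ j) (1 / ((n : ℝ) + 1)),
          p ∉ nearSet C M w ψ ∧ p ∈ closure (nearSet C M w ψ) := by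
      by_contra! hp
      exact hns ((hC.convex_collar _ _ _).isPreconnected.subset_left_of_subset_union
        hC.isOpen_nearSet isClosed_closure.isOpen_compl
        (disjoint_compl_right_iff_subset.2 subset_closure)
        (fun p hpA => or_iff_not_imp_left.2 fun hpU => hp p hpA hpU) hne)
    have hp0 : 0 < h p := hC.pos_of_ne_zero (subset_closure hp) fun h0 => by
      simpa [h0] using hv.pos hC j hp
    have hinv := inv_pos.2 hp0
    refine ⟨(h p)⁻¹ • p, hC.smul_mem hinv hp, by rw [map_smul, hpT], ?_, ?_, ?_, fun hU => ?_⟩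
    · rw [map_smul, smul_eq_mul, inv_mul_lt_iff₀ hp0, mul_comm]
      exact hpj
    · rw [map_smul, smul_eq_mul, inv_mul_cancel₀ hp0.ne']
    · exact hC.smul_mem_nearSet hinv (hC.mem_nearSet_of_mem_closure (by linarith) hp hpcl)
    · refine hpU ?_
      have := hC.smul_mem_nearSet hp0 hU
      rwa [smul_inv_smul₀ hp0.ne'] at this
  choose p hp hpT hpj hph hp4 hpU using hkey
  obtain ⟨x, hx⟩ := exists_tendsto_ultrafilter_of_norm_le (hyperfilter ℕ) p 1
    (.of_forall fun n => (hC.norm_le (hp n)).trans (hph n).le)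
  have hhx : h x = 1 :=
    tendsto_nhds_unique ((h.continuous.tendsto _).comp hx)
      (by simp only [Function.comp_def, hph]; exact tendsto_const_nhds)
  have hjx : φ j x = 0 := by
    have h0 : Tendsto (fun n : ℕ => 1 / ((n : ℝ) + 1)) (hyperfilter ℕ) (nhds 0) :=
      tendsto_one_div_add_atTop_nhds_zero_nat.mono_left Nat.hyperfilter_le_atTop
    exact tendsto_nhds_unique (((φ j).continuous.tendsto _).comp hx)
      (squeeze_zero (fun n => hv.nonneg j _ (hp n)) (fun n => (hpj n).le) h0)
  obtain ⟨n, hn⟩ := eventually_mem_nearSet hC hK hI hcard hv hw (hyperfilter ℕ) hM hp hpT hp4 hx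
    (by rintro rfl; simp at hhx) hjx
  exact hpU n hn

/-- If a sequence in a flat converges to the boundary while staying near a second flat, then
the vertices of the first flat lie in the span of the second one. -/
lemma vertices_mem_span_of_near (hC : IsSharpCone C h) (hK : IsCocompactCone C K)
    (hI : IsIndecomposableCone C) (hcard : Module.finrank ℝ V = Fintype.card ι + 1)
    (hι : 3 ≤ Fintype.card ι)
    (hv : IsConeFlat C v φ) (hw : IsConeFlat C w ψ) {p : ℕ → V} (hp : ∀ n, p n ∈ C)
    (hpT : ∀ n, simplexProj v φ (p n) = p n) (hnear : ∀ n, p n ∈ nearSet C M w ψ)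
    {x : V} (hx : Tendsto p atTop (nhds x)) (hx0 : x ≠ 0) {j₀ : ι} (hj₀ : φ j₀ x = 0) (j : ι) :
    simplexProj w ψ (v j) = v j := by
  have hpos : ∀ q ∈ C, 0 < h q := fun q hq => hC.pos_of_ne_zero (subset_closure hq) fun h0 => by
    simpa [h0] using hv.pos hC j hq
  have hM : 1 < M := by
    obtain ⟨y, -, h1, h2⟩ := hnear 0
    have h3 := hpos _ (hC.add_mem h1 h2)
    rw [map_add, map_sub, map_sub, map_smul, smul_eq_mul] at h3
    have h4 := hpos _ (hp 0)
    by_contra! hM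
    nlinarith
  choose ε hε hεU using exists_collar_subset hC hK hI hcard hv hw hM
  have hxcl : x ∈ closure C :=
    isClosed_closure.mem_of_tendsto hx (.of_forall fun n => subset_closure (hp n))
  have hbase : collar C h (simplexProj v φ) (φ j₀) (ε j₀) ⊆ nearSet C M w ψ := by
    refine hεU j₀ ?_
    have h1 : ∀ᶠ n in atTop, φ j₀ (p n) < ε j₀ * h (p n) := by
      refine (((φ j₀).continuous.tendsto _).comp hx).eventually_lt
        (((h.continuous.tendsto _).comp hx).const_mul _) ?_
      rw [hj₀]
      exact mul_pos (hε j₀) (hC.pos_of_ne_zero hxcl hx0)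
    obtain ⟨n, hn⟩ := h1.exists
    exact ⟨p n, ⟨hp n, hpT n, hn⟩, hnear n⟩
  -- the sequence of interior points converging to a vertex
  let s : ℕ → ι → V := fun n l => v l + (1 / ((n : ℝ) + 1)) • ∑ k, v k
  have hsT : ∀ n l, simplexProj v φ (s n l) = s n l := fun n l => by
    simp [s, hv.simplexProj_vertex]
  have hsC : ∀ n l, s n l ∈ C := fun n l => by
    refine hv.mem_of_pos hC (fun k => ?_) (hsT n l)
    have h1 : φ k (s n l) = (if k = l then 1 else 0) + 1 / ((n : ℝ) + 1) := by
      simp [s, hv.dual]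
    rw [h1]
    have h2 : 0 < 1 / ((n : ℝ) + 1) := Nat.one_div_pos_of_nat
    split_ifs <;> linarith
  have hs : ∀ l, Tendsto (fun n => s n l) atTop (nhds (v l)) := fun l => by
    have h1 := (tendsto_const_nhds (x := v l)).add
      ((tendsto_one_div_add_atTop_nhds_zero_nat (𝕜 := ℝ)).smul_const (∑ k, v k))
    rwa [zero_smul, add_zero] at h1
  have hsA : ∀ k l, k ≠ l →
      ∀ᶠ n in atTop, s n l ∈ collar C h (simplexProj v φ) (φ k) (ε k) := fun k l hkl => by
    have h1 : ∀ᶠ n in atTop, φ k (s n l) < ε k * h (s n l) := by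
      refine (((φ k).continuous.tendsto _).comp (hs l)).eventually_lt
        (((h.continuous.tendsto _).comp (hs l)).const_mul _) ?_
      rw [hv.dual, if_neg hkl]
      exact mul_pos (hε k) (hC.pos_of_ne_zero (hv.mem l) (hv.ne_zero l))
    filter_upwards [h1] with n hn using ⟨hsC n l, hsT n l, hn⟩
  have hall : ∀ k, collar C h (simplexProj v φ) (φ k) (ε k) ⊆ nearSet C M w ψ := fun k => by
    obtain ⟨l, hl⟩ : ∃ l, l ∉ ({j₀, k} : Finset ι) := by
      by_contra! hl
      have h1 := (Finset.card_le_card (s := Finset.univ) fun l _ => hl l).trans Finset.card_le_two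
      rw [Finset.card_univ] at h1
      omega
    simp only [Finset.mem_insert, Finset.mem_singleton, not_or] at hl
    obtain ⟨n, h1, h2⟩ := ((hsA j₀ l (Ne.symm hl.1)).and (hsA k l (Ne.symm hl.2))).exists
    exact hεU k ⟨_, h2, hbase h1⟩
  obtain ⟨k, hk⟩ : ∃ k, k ≠ j := by
    have : Nontrivial ι := Fintype.one_lt_card_iff_nontrivial.1 (by omega)
    exact exists_ne j
  obtain ⟨N, hN⟩ := eventually_atTop.1 (hsA k j hk)
  choose y hyT hys hsy using fun n => hall k (hN (n + N) (Nat.le_add_left _ _))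
  exact (limit_of_near_flat hC hK hI hcard hv hw (hyperfilter ℕ) (p := fun n => s (n + N) j)
    (fun n => hsC _ _) hyT hys hsy
    (((tendsto_add_atTop_iff_nat N).2 (hs j)).mono_left Nat.hyperfilter_le_atTop)
    (j := k) (by rw [hv.dual, if_neg hk])).1

end Propagation

/-! ### The cone over a divisible domain -/

section ConeOver

variable {d : ℕ} {Ω : Set (Euc d)}

lemma mem_coneOver_iff {p : Euc d × ℝ} : p ∈ coneOver Ω ↔ 0 < p.2 ∧ p.2⁻¹ • p.1 ∈ Ω := by
  constructor
  · rintro ⟨t, ht, x, hx, rfl⟩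
    simpa [ht, smul_smul, inv_mul_cancel₀ ht.ne'] using hx
  · rintro ⟨ht, hx⟩
    refine ⟨p.2, ht, _, hx, ?_⟩
    ext1
    · simp [smul_smul, mul_inv_cancel₀ ht.ne']
    · simp

lemma prodMk_one_mem_coneOver {x : Euc d} : (x, (1 : ℝ)) ∈ coneOver Ω ↔ x ∈ Ω := by
  simp [mem_coneOver_iff]

lemma prodMk_one_mem_closure_coneOver {x : Euc d} (hx : x ∈ closure Ω) :
    (x, (1 : ℝ)) ∈ closure (coneOver Ω) :=
  map_mem_closure (f := fun x : Euc d => (x, (1 : ℝ))) (by fun_prop) hx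
    fun _ hy => prodMk_one_mem_coneOver.2 hy

lemma exists_isSharpCone_coneOver (hne : Ω.Nonempty) (hbd : Bornology.IsBounded Ω)
    (hop : IsOpen Ω) (hconv : Convex ℝ Ω) :
    ∃ c > 0, IsSharpCone (coneOver Ω) ((c : ℝ) • ContinuousLinearMap.snd ℝ (Euc d) ℝ) := by
  obtain ⟨c, hc⟩ := hbd.exists_norm_le
  refine ⟨max c 1, by positivity, ?_, ?_, ?_, ?_, ?_⟩
  · have h1 : coneOver Ω = {p | 0 < p.2} ∩ (fun p : Euc d × ℝ => p.2⁻¹ • p.1) ⁻¹' Ω := by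
      ext p; exact mem_coneOver_iff
    rw [h1]
    refine ContinuousOn.isOpen_inter_preimage ?_ (isOpen_lt continuous_const continuous_snd) hop
    exact (continuous_snd.continuousOn.inv₀ fun p hp => ne_of_gt hp).smul
      continuous_fst.continuousOn
  · rintro _ ⟨t, ht, x, hx, rfl⟩ _ ⟨s, hs, y, hy, rfl⟩ a b ha hb hab
    have hpos : 0 < a * t + b * s := by
      rcases ha.eq_or_lt with rfl | ha
      · rw [zero_add] at hab; subst hab; simpa
      · positivity
    refine ⟨a * t + b * s, hpos, _, hconv hx hy (a := a * t / (a * t + b * s))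
      (b := b * s / (a * t + b * s)) (by positivity) (by positivity)
      (by rw [← add_div, div_self hpos.ne']), ?_⟩
    ext1
    · simp [smul_smul, mul_div_cancel₀ _ hpos.ne']
    · simp
  · rintro t ht _ ⟨s, hs, x, hx, rfl⟩
    exact ⟨t * s, mul_pos ht hs, x, hx, by rw [smul_smul]⟩
  · obtain ⟨x, hx⟩ := hne
    exact ⟨_, prodMk_one_mem_coneOver.2 hx⟩
  · rintro _ ⟨t, ht, x, hx, rfl⟩
    rw [norm_smul, Real.norm_of_nonneg ht.le, Prod.norm_def]
    simp only [smul_apply, map_smul, ContinuousLinearMap.coe_snd', smul_eq_mul, mul_one,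
      norm_one]
    rw [mul_comm t, mul_comm t]
    exact mul_le_mul_of_nonneg_right (max_le_max_right _ (hc x hx)) ht.le

lemma Divides.exists_isCocompactCone {Γ : Subgroup ((Euc d × ℝ) ≃ₗ[ℝ] (Euc d × ℝ))}
    (hΓ : Divides Ω Γ) : ∃ K, IsCocompactCone (coneOver Ω) K := by
  obtain ⟨hpres, -, -, K, hKΩ, hK, hcov⟩ := hΓ
  refine ⟨(fun x => (x, (1 : ℝ))) '' K, ?_, hK.image (by fun_prop), ?_⟩
  · rintro _ ⟨x, hx, rfl⟩
    exact prodMk_one_mem_coneOver.2 (hKΩ hx)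
  rintro _ ⟨s, hs, x, hx, rfl⟩
  rw [← hcov] at hx
  simp only [mem_iUnion] at hx
  obtain ⟨γ, hγ, k, hk, rfl⟩ := hx
  have hmem : ∀ p, γ p ∈ coneOver Ω ↔ p ∈ coneOver Ω := fun p => by
    conv_lhs => rw [← hpres γ hγ]
    exact γ.injective.mem_set_image
  have hsmul : ∀ {t : ℝ}, 0 < t → ∀ {p : Euc d × ℝ}, p ∈ coneOver Ω → t • p ∈ coneOver Ω := by
    rintro t ht _ ⟨s, hs, x, hx, rfl⟩
    exact ⟨t * s, mul_pos ht hs, x, hx, by rw [smul_smul]⟩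
  obtain ⟨r, hr, y, hy, hry⟩ := (hmem _).2 (prodMk_one_mem_coneOver.2 (hKΩ hk))
  have hproj : projAct γ k = y := by
    rw [projAct, hry]; simp [smul_smul, inv_mul_cancel₀ hr.ne']
  have hsr : 0 < r / s := div_pos hr hs
  let e : (Euc d × ℝ) ≃ₗ[ℝ] (Euc d × ℝ) :=
    γ.symm.trans (LinearEquiv.smulOfNeZero ℝ _ (r / s) hsr.ne')
  have he : ∀ p, e p = (r / s) • γ.symm p := fun p => rfl
  refine ⟨e.toContinuousLinearEquiv, fun p => ?_, k, hk, ?_⟩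
  · change e p ∈ _ ↔ _
    rw [he, ← hmem, map_smul, LinearEquiv.apply_symm_apply]
    refine ⟨fun h1 => ?_, hsmul hsr⟩
    have := hsmul (inv_pos.2 hsr) h1
    rwa [inv_smul_smul₀ hsr.ne'] at this
  · change _ = e _
    rw [he, hproj, ← map_smul, smul_smul, div_mul_cancel₀ _ hs.ne', ← hry,
      LinearEquiv.symm_apply_apply]

lemma IsIrreducibleDomain.isIndecomposableCone {h : Euc d × ℝ →L[ℝ] ℝ}
    (hC : IsSharpCone (coneOver Ω) h) (hirr : IsIrreducibleDomain Ω) :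
    IsIndecomposableCone (coneOver Ω) := by
  intro Q hQ hQC
  by_contra! hcon
  obtain ⟨⟨a, ha⟩, b, hb⟩ := hcon
  have hcompl : IsCompl (Q : Euc d × ℝ →ₗ[ℝ] Euc d × ℝ).range
      (Q : Euc d × ℝ →ₗ[ℝ] Euc d × ℝ).ker := by
    exact LinearMap.IsIdempotentElem.isCompl (LinearMap.ext hQ)
  have hr : (Q : Euc d × ℝ →ₗ[ℝ] Euc d × ℝ).range ≠ ⊥ := fun h0 => ha (by
    have : Q a ∈ (Q : Euc d × ℝ →ₗ[ℝ] Euc d × ℝ).range := ⟨a, rfl⟩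
    rwa [h0, Submodule.mem_bot] at this)
  have hk : (Q : Euc d × ℝ →ₗ[ℝ] Euc d × ℝ).ker ≠ ⊥ := fun h0 => hb (by
    have : b - Q b ∈ (Q : Euc d × ℝ →ₗ[ℝ] Euc d × ℝ).ker := by simp [hQ]
    rw [h0, Submodule.mem_bot, sub_eq_zero] at this
    exact this.symm)
  let Q' : Euc d × ℝ →ₗ[ℝ] Euc d × ℝ := LinearMap.id - (Q : Euc d × ℝ →ₗ[ℝ] Euc d × ℝ)
  refine hirr ⟨_, _, (Q : Euc d × ℝ →ₗ[ℝ] Euc d × ℝ) '' coneOver Ω, Q' '' coneOver Ω, hr, hk,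
    fun h0 => hk ?_, fun h0 => hr ?_, hcompl, ?_, ?_, hC.convex.linear_image _,
    hC.convex.linear_image _, ?_, ?_, ?_⟩
  · rw [h0] at hcompl; exact by simpa using hcompl.disjoint
  · rw [h0] at hcompl; exact by simpa using hcompl.symm.disjoint
  · rintro _ ⟨p, -, rfl⟩
    exact ⟨p, rfl⟩
  · rintro _ ⟨p, -, rfl⟩
    simp [Q', hQ]
  · rintro t ht _ ⟨p, hp, rfl⟩
    exact ⟨t • p, hC.smul_mem ht hp, by simp⟩
  · rintro t ht _ ⟨p, hp, rfl⟩
    exact ⟨t • p, hC.smul_mem ht hp, by simp⟩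
  · ext p
    constructor
    · intro hp
      exact ⟨_, ⟨p, hp, rfl⟩, _, ⟨p, hp, rfl⟩, by simp [Q']⟩
    · rintro ⟨_, ⟨p, hp, rfl⟩, _, ⟨q, hq, rfl⟩, rfl⟩
      let L : (Euc d × ℝ) × (Euc d × ℝ) →L[ℝ] Euc d × ℝ :=
        Q.coprod (ContinuousLinearMap.id ℝ _ - Q)
      have hL : IsOpenMap L := L.isOpenMap fun x => ⟨(x, x), by simp [L]⟩
      have hsub : L '' (coneOver Ω ×ˢ coneOver Ω) ⊆ closure (coneOver Ω) := by
        rintro _ ⟨⟨x, y⟩, ⟨hx, hy⟩, rfl⟩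
        exact hC.closure_add_mem (hQC x hx).1 (hQC y hy).2
      have := interior_maximal hsub (hL _ (hC.isOpen.prod hC.isOpen))
      rw [hC.interior_closure] at this
      exact this ⟨(p, q), ⟨hp, hq⟩, rfl⟩

end ConeOver

/-! ### Flats of a domain as flats of its cone -/

section Flats

variable {E : Type*} [NormedAddCommGroup E] [NormedSpace ℝ E]

lemma exists_lineMap_mem_of_mem_intrinsicInterior {s : Set E} {x a : E}
    (hx : x ∈ intrinsicInterior ℝ s) (ha : a ∈ s) :
    ∃ t : ℝ, 1 < t ∧ AffineMap.lineMap a x t ∈ s := by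
  obtain ⟨y, hy, rfl⟩ := mem_intrinsicInterior.1 hx
  let f : ℝ → affineSpan ℝ s := fun t =>
    ⟨AffineMap.lineMap a (y : E) t, AffineMap.lineMap_mem t (subset_affineSpan ℝ s ha) y.2⟩
  have hf : Continuous f := Continuous.subtype_mk AffineMap.lineMap_continuous _
  have hf1 : f 1 = y := Subtype.ext (AffineMap.lineMap_apply_one a (y : E))
  have h1 : f ⁻¹' interior ((↑) ⁻¹' s) ∈ nhds 1 :=
    (isOpen_interior.preimage hf).mem_nhds (by rwa [mem_preimage, hf1])
  obtain ⟨t, ht, ht1⟩ := ((eventually_mem_nhdsWithin (a := (1 : ℝ)) (s := Ioi 1)).and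
    (mem_nhdsWithin_of_mem_nhds h1)).exists
  exact ⟨t, ht, interior_subset (s := ((↑) ⁻¹' s : Set (affineSpan ℝ s))) ht1⟩

lemma mem_convexHull_range_iff {ι : Type*} [Fintype ι] {v : ι → E} {x : E} :
    x ∈ convexHull ℝ (range v) ↔
      ∃ c : ι → ℝ, (∀ i, 0 ≤ c i) ∧ ∑ i, c i = 1 ∧ ∑ i, c i • v i = x := by
  constructor
  · intro hx
    refine convexHull_min (t := {x | ∃ c : ι → ℝ, (∀ i, 0 ≤ c i) ∧ ∑ i, c i = 1 ∧
      ∑ i, c i • v i = x}) ?_ ?_ hx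
    · classical
      rintro _ ⟨i, rfl⟩
      exact ⟨Pi.single i 1, fun j => by by_cases hj : j = i <;> simp [hj], by simp,
        by simp [Pi.single_apply]⟩
    · rintro _ ⟨c, hc, hc1, rfl⟩ _ ⟨c', hc', hc1', rfl⟩ a b ha hb hab
      refine ⟨fun i => a * c i + b * c' i,
        fun i => add_nonneg (mul_nonneg ha (hc i)) (mul_nonneg hb (hc' i)), ?_, ?_⟩
      · rw [Finset.sum_add_distrib, ← Finset.mul_sum, ← Finset.mul_sum, hc1, hc1', mul_one,
          mul_one, hab]
      · simp only [add_smul, Finset.sum_add_distrib, mul_smul, Finset.smul_sum]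
  · rintro ⟨c, hc, hc1, rfl⟩
    exact (convex_convexHull ℝ _).sum_mem (fun i _ => hc i) hc1
      fun i _ => subset_convexHull ℝ _ (mem_range_self i)

/-- A point of a simplex lying on a facet is not in its relative interior. -/
lemma AffineIndependent.sum_smul_notMem_intrinsicInterior {ι : Type*} [Fintype ι] [DecidableEq ι]
    {v : ι → E} (hv : AffineIndependent ℝ v) {c : ι → ℝ} (hc : ∑ i, c i = 1) {j : ι}
    (hj : c j = 0) : ∑ i, c i • v i ∉ intrinsicInterior ℝ (convexHull ℝ (range v)) := by
  intro hx
  obtain ⟨t, ht, hmem⟩ := exists_lineMap_mem_of_mem_intrinsicInterior hx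
    (subset_convexHull ℝ _ (mem_range_self j))
  obtain ⟨b, hb, hb1, hbv⟩ := mem_convexHull_range_iff.1 hmem
  have h1 := affineIndependent_iff.1 hv Finset.univ
    (fun i => b i - t * c i - (1 - t) * if i = j then 1 else 0)
    (by simp only [Finset.sum_sub_distrib, ← Finset.mul_sum, hb1, hc, Finset.sum_ite_eq',
          Finset.mem_univ, if_true]; ring)
    (by
      simp only [sub_smul, Finset.sum_sub_distrib, hbv, mul_smul, ← Finset.smul_sum]
      simp [AffineMap.lineMap_apply_module]
      module) j (Finset.mem_univ j)
  have h2 := hb j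
  simp [hj] at h1
  linarith

variable {d : ℕ} {Ω : Set (Euc d)} {v : Fin d → Euc d} {h : Euc d × ℝ →L[ℝ] ℝ}
  {φ : Fin d → Euc d × ℝ →L[ℝ] ℝ}

lemma sum_smul_prodMk_one {ι : Type*} [Fintype ι] (u : ι → E) (c : ι → ℝ) :
    ∑ i, c i • (u i, (1 : ℝ)) = (∑ i, c i • u i, ∑ i, c i) := by
  ext1 <;> simp [Prod.fst_sum, Prod.snd_sum]

lemma IsFlatWith.notMem_of_apply_eq_zero (hv : IsFlatWith Ω v) {c : Fin d → ℝ}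
    (hc0 : ∀ i, 0 ≤ c i) (hc : ∑ i, c i = 1) {j : Fin d} (hj : c j = 0) :
    ∑ i, c i • v i ∉ Ω :=
  (hv.2.2.2 ⟨mem_convexHull_range_iff.2 ⟨c, hc0, hc, rfl⟩,
    hv.1.sum_smul_notMem_intrinsicInterior hc hj⟩).2

/-- The facets of a flat are supported by linear functionals. -/
lemma IsFlatWith.exists_isConeFlat (hd : 2 ≤ d) (hC : IsSharpCone (coneOver Ω) h)
    (hv : IsFlatWith Ω v) : ∃ φ, IsConeFlat (coneOver Ω) (fun j => (v j, (1 : ℝ))) φ := by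
  have hvcl : ∀ j, (v j, (1 : ℝ)) ∈ closure (coneOver Ω) := fun j =>
    prodMk_one_mem_closure_coneOver (hv.2.1 j).1
  have hne : (convexHull ℝ (range v)).Nonempty :=
    ⟨v ⟨0, by omega⟩, subset_convexHull ℝ _ (mem_range_self _)⟩
  obtain ⟨o, ho⟩ := hne.intrinsicInterior (convex_convexHull ℝ _)
  obtain ⟨c, hc0, hc1, rfl⟩ := mem_convexHull_range_iff.1 (intrinsicInterior_subset ho)
  have hoC : ∑ j, c j • (v j, (1 : ℝ)) ∈ coneOver Ω := by
    rw [sum_smul_prodMk_one, hc1, prodMk_one_mem_coneOver]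
    exact hv.2.2.1 ho
  have key : ∀ j, ∃ f : Euc d × ℝ →L[ℝ] ℝ, (∀ p ∈ coneOver Ω, 0 ≤ f p) ∧
      ∀ k, f (v k, 1) = if j = k then 1 else 0 := fun j => by
    have hd1 : (0 : ℝ) < (d : ℝ) - 1 := by
      have : (2 : ℝ) ≤ d := by exact_mod_cast hd
      linarith
    let e : Fin d → ℝ := fun k => if k = j then 0 else 1 / ((d : ℝ) - 1)
    have he0 : ∀ k, 0 ≤ e k := fun k => by
      simp only [e]; split_ifs <;> positivity
    have he1 : ∑ k, e k = 1 := by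
      have h1 : ∀ k, e k = 1 / ((d : ℝ) - 1) - if k = j then 1 / ((d : ℝ) - 1) else 0 := fun k => by
        simp only [e]; split_ifs <;> simp
      simp only [h1, Finset.sum_sub_distrib, Finset.sum_const, Finset.card_univ, Fintype.card_fin,
        Finset.sum_ite_eq', Finset.mem_univ, if_true, nsmul_eq_mul]
      field_simp
    have hej : e j = 0 := if_pos rfl
    have hnot : ∑ k, e k • (v k, (1 : ℝ)) ∉ coneOver Ω := by
      rw [sum_smul_prodMk_one, he1, prodMk_one_mem_coneOver]
      exact hv.notMem_of_apply_eq_zero he0 he1 hej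
    obtain ⟨f, hf⟩ := geometric_hahn_banach_point_open hC.convex hC.isOpen hnot
    have hnn : ∀ p ∈ coneOver Ω, 0 ≤ f p := fun p hp => by
      by_contra! hneg
      obtain ⟨n, hn⟩ := exists_nat_gt (f (∑ k, e k • (v k, (1 : ℝ))) / f p)
      have h1 := hf _ (hC.smul_mem (t := |(n : ℝ)| + 1) (by positivity) hp)
      rw [div_lt_iff_of_neg hneg] at hn
      rw [map_smul, smul_eq_mul, Nat.abs_cast] at h1
      linarith
    have hnn' : ∀ k, 0 ≤ f (v k, 1) := fun k =>
      IsSharpCone.functional_nonneg_closure hnn (hvcl k)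
    have hle : ∑ k, e k * f (v k, 1) ≤ 0 := by
      have h1 : ∀ x ∈ closure (coneOver Ω), f (∑ k, e k • (v k, (1 : ℝ))) ≤ f x := fun x hx =>
        closure_minimal (t := {x | f (∑ k, e k • (v k, (1 : ℝ))) ≤ f x})
          (fun p hp => (hf p hp).le) (isClosed_le continuous_const f.continuous) hx
      have h2 := h1 0 hC.zero_mem_closure
      simpa only [map_sum, map_smul, smul_eq_mul, map_zero] using h2
    have hz : ∀ k, k ≠ j → f (v k, 1) = 0 := fun k hk => by
      have h1 := (Finset.sum_eq_zero_iff_of_nonneg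
        fun i _ => mul_nonneg (he0 i) (hnn' i)).1 (le_antisymm hle
          (Finset.sum_nonneg fun i _ => mul_nonneg (he0 i) (hnn' i))) k (Finset.mem_univ k)
      refine (mul_eq_zero.1 h1).resolve_left ?_
      simp only [e, if_neg hk]
      positivity
    have hfj : f (v j, 1) ≠ 0 := fun h0 => by
      have h1 := hf _ hoC
      have h2 : ∀ k, f (v k, 1) = 0 := fun k => by
        by_cases hk : k = j
        · rw [hk, h0]
        · exact hz k hk
      simp only [map_sum, map_smul, h2, smul_zero, lt_self_iff_false] at h1
    refine ⟨(f (v j, 1))⁻¹ • f, fun p hp => mul_nonneg (inv_nonneg.2 (hnn' j)) (hnn p hp),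
      fun k => ?_⟩
    by_cases hk : j = k
    · subst hk; simp [hfj]
    · simp [hk, hz k (Ne.symm hk)]
  choose φ hφ0 hφ using key
  refine ⟨φ, hvcl, hφ0, hφ, _, hoC, ?_⟩
  rw [simplexProj_apply]
  refine Finset.sum_congr rfl fun j _ => ?_
  simp only [map_sum, map_smul, hφ, smul_eq_mul, mul_ite, mul_one, mul_zero, Finset.sum_ite_eq,
    Finset.mem_univ, if_true]

lemma IsFlatWith.simplexProj_of_mem (hφ : IsConeFlat (coneOver Ω) (fun j => (v j, (1 : ℝ))) φ)
    {x : Euc d} (hx : x ∈ convexHull ℝ (range v)) :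
    simplexProj (fun j => (v j, (1 : ℝ))) φ (x, 1) = (x, 1) := by
  obtain ⟨c, -, hc1, rfl⟩ := mem_convexHull_range_iff.1 hx
  have h1 : (∑ i, c i • v i, (1 : ℝ)) = ∑ i, c i • (v i, (1 : ℝ)) := by
    rw [sum_smul_prodMk_one, hc1]
  rw [h1, map_sum]
  refine Finset.sum_congr rfl fun j _ => ?_
  rw [map_smul]
  exact congrArg (c j • ·) (hφ.simplexProj_vertex j)

lemma IsFlatWith.mem_flat_iff (hv : IsFlatWith Ω v)
    (hφ : IsConeFlat (coneOver Ω) (fun j => (v j, (1 : ℝ))) φ) {x : Euc d} :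
    x ∈ intrinsicInterior ℝ (convexHull ℝ (range v)) ↔
      x ∈ Ω ∧ simplexProj (fun j => (v j, (1 : ℝ))) φ (x, 1) = (x, 1) := by
  refine ⟨fun hx => ⟨hv.2.2.1 hx, simplexProj_of_mem hφ (intrinsicInterior_subset hx)⟩, ?_⟩
  rintro ⟨hx, hxT⟩
  rw [simplexProj_apply, sum_smul_prodMk_one, Prod.mk.injEq] at hxT
  by_contra hx'
  exact (hv.2.2.2 ⟨mem_convexHull_range_iff.2 ⟨_, fun j =>
    hφ.nonneg j _ (prodMk_one_mem_coneOver.2 hx), hxT.2, hxT.1⟩, hx'⟩).2 hx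

lemma IsFlatWith.exists_apply_eq_zero (hC : IsSharpCone (coneOver Ω) h) (hv : IsFlatWith Ω v)
    (hφ : IsConeFlat (coneOver Ω) (fun j => (v j, (1 : ℝ))) φ) {x : Euc d}
    (hx : x ∈ closure (intrinsicInterior ℝ (convexHull ℝ (range v))) \
      intrinsicInterior ℝ (convexHull ℝ (range v))) : ∃ j, φ j (x, 1) = 0 := by
  have hxS : x ∈ convexHull ℝ (range v) :=
    closure_minimal intrinsicInterior_subset ((finite_range v).isClosed_convexHull ℝ) hx.1
  obtain ⟨hxcl, hxΩ⟩ := hv.2.2.2 ⟨hxS, hx.2⟩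
  by_contra! hne
  exact hxΩ (prodMk_one_mem_coneOver.1 (hφ.mem_of_pos hC (fun j =>
    (hφ.nonneg_closure j (prodMk_one_mem_closure_coneOver hxcl)).lt_of_ne' (hne j))
    (simplexProj_of_mem hφ hxS)))

end Flats

/-! ### Cross-ratios and the cone -/

section CrossRatio

variable {d : ℕ} {Ω : Set (Euc d)} {h : Euc d × ℝ →L[ℝ] ℝ}

lemma crossRatio_eq {x y z w : Euc d} {a b a' b' : ℝ} (hb : 0 < b) (hab : a + b = 1)
    (ha' : 0 < a') (hab' : a' + b' = 1) (hx : a • z + b • y = x)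
    (hy : a' • x + b' • w = y) (hxy : x ≠ y) : crossRatio z x y w = (b * a')⁻¹ := by
  have h0 : 0 < ‖x - y‖ := norm_pos_iff.2 (sub_ne_zero.2 hxy)
  have e1 : x - y = a • (z - y) := by
    rw [← hx, eq_sub_of_add_eq' hab]; module
  have e2 : z - x = b • (z - y) := by
    rw [← hx, eq_sub_of_add_eq hab]; module
  have e3 : x - y = b' • (x - w) := by
    rw [← hy, eq_sub_of_add_eq hab']; module
  have e4 : y - w = a' • (x - w) := by
    rw [← hy, eq_sub_of_add_eq' hab']; module
  have n1 : 0 < ‖z - y‖ := norm_pos_iff.2 fun h1 => hxy (sub_eq_zero.1 (by rw [e1, h1, smul_zero]))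
  have n2 : 0 < ‖x - w‖ := norm_pos_iff.2 fun h1 => hxy (sub_eq_zero.1 (by rw [e3, h1, smul_zero]))
  rw [crossRatio, e2, e4, norm_smul, norm_smul, Real.norm_of_nonneg hb.le,
    Real.norm_of_nonneg ha'.le]
  field_simp

lemma mem_nearSet_of_crossRatio_le (hC : IsSharpCone (coneOver Ω) h) {x y z w : Euc d}
    (hx : x ∈ Ω) (hy : y ∈ Ω) (hxy : x ≠ y) (hz : z ∈ closure Ω) (hw : w ∈ closure Ω)
    (hxz : x ∈ openSegment ℝ z y) (hyw : y ∈ openSegment ℝ x w) {B : ℝ}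
    (hB : crossRatio z x y w ≤ B) {ι : Type*} [Fintype ι] {u : ι → Euc d × ℝ}
    {ψ : ι → Euc d × ℝ →L[ℝ] ℝ} (hyT : simplexProj u ψ (y, 1) = (y, 1)) :
    (x, (1 : ℝ)) ∈ nearSet (coneOver Ω) (2 * B + 1) u ψ := by
  obtain ⟨a, b, ha, hb, hab, hx'⟩ := hxz
  obtain ⟨a', b', ha', hb', hab', hy'⟩ := hyw
  rw [crossRatio_eq hb hab ha' hab' hx' hy' hxy] at hB
  have hxC : (x, (1 : ℝ)) ∈ coneOver Ω := prodMk_one_mem_coneOver.2 hx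
  have hyC : (y, (1 : ℝ)) ∈ coneOver Ω := prodMk_one_mem_coneOver.2 hy
  have hzC := prodMk_one_mem_closure_coneOver hz
  have hwC := prodMk_one_mem_closure_coneOver hw
  have ez : (x, (1 : ℝ)) = a • (z, (1 : ℝ)) + b • (y, (1 : ℝ)) := by
    ext1 <;> simp [hx', hab]
  have ew : (y, (1 : ℝ)) = a' • (x, (1 : ℝ)) + b' • (w, (1 : ℝ)) := by
    ext1 <;> simp [hy', hab']
  refine ⟨(2 / a') • (y, (1 : ℝ)), by rw [map_smul, hyT], ?_, ?_⟩
  · have h1 := hC.add_closure_mem (hC.smul_mem (inv_pos.2 ha') hyC)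
      (hC.closure_smul_mem (div_pos hb' ha') hwC)
    have h2 : (2 / a') • (y, (1 : ℝ)) - (x, (1 : ℝ)) =
        a'⁻¹ • (y, (1 : ℝ)) + (b' / a') • (w, (1 : ℝ)) := by
      have h3 : (x, (1 : ℝ)) = a'⁻¹ • ((y, (1 : ℝ)) - b' • (w, (1 : ℝ))) := by
        rw [ew, add_sub_cancel_right, inv_smul_smul₀ ha'.ne']
      rw [h3]
      module
    rwa [h2]
  · have h1 := hC.add_closure_mem
      (hC.smul_mem (show 0 < 2 * B + 1 - 2 * (b * a')⁻¹ by linarith) hxC)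
      (hC.closure_smul_mem (show 0 < 2 * (b * a')⁻¹ * a by positivity) hzC)
    have h2 : (2 * B + 1) • (x, (1 : ℝ)) - (2 / a') • (y, (1 : ℝ)) =
        (2 * B + 1 - 2 * (b * a')⁻¹) • (x, (1 : ℝ)) +
          (2 * (b * a')⁻¹ * a) • (z, (1 : ℝ)) := by
      have h3 : a • (z, (1 : ℝ)) = (x, (1 : ℝ)) - b • (y, (1 : ℝ)) := by
        rw [ez, add_sub_cancel_right]
      have h4 : 2 / a' = 2 * (b * a')⁻¹ * b := by field_simp
      rw [mul_smul _ a, h3, h4]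
      module
    rwa [h2]

end CrossRatio

theorem distance_between_flats_tends_to_infinity {d : ℕ} (Ω : Set (Euc d)) (hne : Ω.Nonempty)
    (hbd : Bornology.IsBounded Ω) (hop : IsOpen Ω) (hconv : Convex ℝ Ω)
    (hd : 3 ≤ d) (hirr : IsIrreducibleDomain Ω)
    (Γ : Subgroup ((Euc d × ℝ) ≃ₗ[ℝ] (Euc d × ℝ)))
    (htf : TorsionFreeSub Γ) (hdiv : Divides Ω Γ)
    (F₁ F₂ : Set (Euc d)) (hF₁ : IsFlat Ω F₁) (hF₂ : IsFlat Ω F₂) (hne12 : F₁ ≠ F₂)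
    (x y z w : ℕ → Euc d) (xl yl : Euc d)
    (hx : ∀ i, x i ∈ F₁) (hy : ∀ i, y i ∈ F₂) (hxy : ∀ i, x i ≠ y i)
    (hxl : xl ∈ closure F₁ \ F₁) (hyl : yl ∈ closure F₂ \ F₂)
    (hxconv : Tendsto x atTop (nhds xl)) (hyconv : Tendsto y atTop (nhds yl))
    (hz : ∀ i, z i ∈ closure Ω \ Ω) (hw : ∀ i, w i ∈ closure Ω \ Ω)
    (hbet₁ : ∀ i, x i ∈ openSegment ℝ (z i) (y i))
    (hbet₂ : ∀ i, y i ∈ openSegment ℝ (x i) (w i)) :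
    Tendsto (fun i => crossRatio (z i) (x i) (y i) (w i)) atTop atTop := by
  obtain ⟨c, -, hC⟩ := exists_isSharpCone_coneOver hne hbd hop hconv
  obtain ⟨K, hK⟩ := hdiv.exists_isCocompactCone
  have hI := hirr.isIndecomposableCone hC
  obtain ⟨u, hu, rfl⟩ := hF₁
  obtain ⟨v, hv, rfl⟩ := hF₂
  obtain ⟨φ, hφ⟩ := hu.exists_isConeFlat (by omega) hC
  obtain ⟨ψ, hψ⟩ := hv.exists_isConeFlat (by omega) hC
  obtain ⟨j₀, hj₀⟩ := hu.exists_apply_eq_zero hC hφ hxl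
  have hcard : Module.finrank ℝ (Euc d × ℝ) = Fintype.card (Fin d) + 1 := by simp
  by_contra hcon
  rw [Filter.tendsto_atTop] at hcon
  push Not at hcon
  obtain ⟨B, hB⟩ := hcon
  obtain ⟨s, hs, hsB⟩ := extraction_of_frequently_atTop hB
  have hxΩ : ∀ i, x i ∈ Ω := fun i => hu.2.2.1 (hx i)
  have hyΩ : ∀ i, y i ∈ Ω := fun i => hv.2.2.1 (hy i)
  have hvert : ∀ j, simplexProj (fun j => (v j, (1 : ℝ))) ψ (u j, 1) = (u j, 1) :=
    vertices_mem_span_of_near hC hK hI hcard (by simpa using hd) hφ hψ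
      (p := fun n => (x (s n), (1 : ℝ))) (fun n => prodMk_one_mem_coneOver.2 (hxΩ _))
      (fun n => ((hu.mem_flat_iff hφ).1 (hx _)).2)
      (fun n => mem_nearSet_of_crossRatio_le hC (hxΩ _) (hyΩ _) (hxy _) (hz _).1 (hw _).1
        (hbet₁ _) (hbet₂ _) (hsB n).le ((hv.mem_flat_iff hψ).1 (hy _)).2)
      ((hxconv.comp hs.tendsto_atTop).prodMk_nhds tendsto_const_nhds)
      (by simp [Prod.ext_iff]) hj₀
  have hle : Submodule.span ℝ (range fun j => (u j, (1 : ℝ))) ≤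
      Submodule.span ℝ (range fun j => (v j, (1 : ℝ))) := by
    rw [Submodule.span_le]
    rintro _ ⟨j, rfl⟩
    exact hψ.simplexProj_eq_iff.1 (hvert j)
  have heq := Submodule.eq_of_le_of_finrank_eq hle (by
    rw [finrank_span_eq_card hφ.linearIndependent, finrank_span_eq_card hψ.linearIndependent])
  refine hne12 (Set.ext fun p => ?_)
  rw [hu.mem_flat_iff hφ, hv.mem_flat_iff hψ, hφ.simplexProj_eq_iff, hψ.simplexProj_eq_iff, heq]
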